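/- arXiv:math/0007005 — 2 statements merged into one kernel-verified Lean document; each statement's English description precedes it below -/
import Mathlib

section
/- Let 1 ≤ i < j ≤ n−1 and let q ∈ ℂ* not be a root of unity. Then the dimension of the ℂ-linear span of the vectors e_C^{ij} ∈ Λ^iℂⁿ ⊗ Λ^jℂⁿ, where C ranges over all monogressive ij-effective orthocell data in S_n, equals D(n;i,j) = C(n,i)·C(n,j) − C(n,i−1)·C(n,j+1). -/
open Equiv Finset
open scoped TensorProduct

noncomputable section

namespace QFlag
/-- The number of inversions of a permutation of `Fin n`
(the length `ℓ(w)` of `w` in the Coxeter group `Sₙ`). -/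
def invCount {n : ℕ} (w : Equiv.Perm (Fin n)) : ℕ :=
  (Finset.univ.filter fun p : Fin n × Fin n => p.1 < p.2 ∧ w p.2 < w p.1).card

/-- The product `s_L = ∏_{k ∈ L} (a_k b_k)` of the transpositions of the datum
selected by `L ⊆ {1, …, d}` (the factors pairwise commute for an orthocell datum). -/
def sL {n d : ℕ} (t : Fin d → Fin n × Fin n) (L : Finset (Fin d)) : Equiv.Perm (Fin n) :=
  ((L.sort (· ≤ ·)).map fun k => Equiv.swap (t k).1 (t k).2).prod

/-- `t` lists the transpositions `(a_k b_k)` of an orthocell datum: `a_k < b_k` and the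
two-element sets `{a_k, b_k}` are pairwise disjoint. -/
def IsOrthocell {n d : ℕ} (t : Fin d → Fin n × Fin n) : Prop :=
  (∀ k, (t k).1 < (t k).2) ∧
  ∀ k k', k ≠ k' →
    ({(t k).1, (t k).2} : Set (Fin n)) ∩ {(t k').1, (t k').2} = ∅

/-- The orthocell datum `(w; t_1, …, t_d)` is monogressive:
`ℓ(s_L w) = ℓ(w) + |L|` for every `L ⊆ {1, …, d}`. -/
def Monogressive {n d : ℕ} (w : Equiv.Perm (Fin n)) (t : Fin d → Fin n × Fin n) : Prop :=
  ∀ L : Finset (Fin d), invCount (sL t L * w) = invCount w + L.card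

/-- The set `w({1, …, i})` (where `{1, …, i}` means the first `i` elements of `Fin n`). -/
def firstSet {n : ℕ} (w : Equiv.Perm (Fin n)) (i : ℕ) : Finset (Fin n) :=
  (Finset.univ.filter fun p : Fin n => (p : ℕ) < i).image w

/-- The orthocell datum `(w; t_1, …, t_d)` is `i`-effective: for every `k` exactly one of
`a_k`, `b_k` belongs to `w({1, …, i})`. -/
def Effective {n d : ℕ} (w : Equiv.Perm (Fin n)) (t : Fin d → Fin n × Fin n) (i : ℕ) : Prop :=
  ∀ k, Xor' ((t k).1 ∈ firstSet w i) ((t k).2 ∈ firstSet w i)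
/-- The vector `e^i_w = e_{w(1)} ∧ ⋯ ∧ e_{w(i)} ∈ Λ^i ℂⁿ`. -/
def eW (n i : ℕ) (w : Equiv.Perm (Fin n)) : ⋀[ℂ]^i (Fin n → ℂ) :=
  ⟨ExteriorAlgebra.ιMulti ℂ i fun k : Fin i =>
      if h : (k : ℕ) < n then Pi.single (w ⟨k, h⟩) (1 : ℂ) else 0,
    ExteriorAlgebra.ιMulti_range ℂ i (Set.mem_range_self _)⟩

/-- The vector
`e_C^{ij} = ∑_{L ⊆ {1,…,d}} q^{|L|} e^i_{s_{L̄} w} ⊗ e^j_{s_L w} ∈ Λ^iℂⁿ ⊗ Λ^jℂⁿ`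
attached to the orthocell datum `C = (w; t_1, …, t_d)`. -/
def eT {n d : ℕ} (q : ℂ) (i j : ℕ) (w : Equiv.Perm (Fin n)) (t : Fin d → Fin n × Fin n) :
    (⋀[ℂ]^i (Fin n → ℂ)) ⊗[ℂ] (⋀[ℂ]^j (Fin n → ℂ)) :=
  ∑ L : Finset (Fin d),
    q ^ L.card • (eW n i (sL t Lᶜ * w) ⊗ₜ[ℂ] eW n j (sL t L * w))

/-- The canonical `AddCommGroup` structure on a subspace of `Λ^iℂⁿ ⊗ Λ^jℂⁿ` (stated as an
instance to help typeclass resolution). -/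
noncomputable instance {n i j : ℕ}
    (p : Submodule ℂ ((⋀[ℂ]^i (Fin n → ℂ)) ⊗[ℂ] (⋀[ℂ]^j (Fin n → ℂ)))) :
    AddCommGroup p :=
  @Submodule.addCommGroup ℂ ((⋀[ℂ]^i (Fin n → ℂ)) ⊗[ℂ] (⋀[ℂ]^j (Fin n → ℂ))) _
    (by infer_instance) (by infer_instance) p


def cnt {n : ℕ} (S : Finset (Fin n)) (p : ℕ) : ℕ := (S.filter (fun x : Fin n => (x : ℕ) < p)).card

def Good {n : ℕ} (I J : Finset (Fin n)) : Prop := ∀ p, cnt I p ≤ cnt J p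

def mix {n : ℕ} (p : ℕ) (A B : Finset (Fin n)) : Finset (Fin n) :=
  A.filter (fun x : Fin n => (x : ℕ) < p) ∪ B.filter (fun x : Fin n => ¬ (x : ℕ) < p)

lemma cnt_zero {n : ℕ} (S : Finset (Fin n)) : cnt S 0 = 0 := by
  simp [cnt]

lemma cnt_top {n : ℕ} (S : Finset (Fin n)) : cnt S n = S.card := by
  simp [cnt]

lemma cnt_mono {n : ℕ} (S : Finset (Fin n)) {p r : ℕ} (h : p ≤ r) : cnt S p ≤ cnt S r := by
  apply Finset.card_le_card
  intro x hx
  simp only [Finset.mem_filter] at hx ⊢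
  exact ⟨hx.1, by omega⟩

lemma cnt_succ_le {n : ℕ} (S : Finset (Fin n)) (p : ℕ) : cnt S (p + 1) ≤ cnt S p + 1 := by
  unfold cnt
  have h : S.filter (fun x : Fin n => (x : ℕ) < p + 1) ⊆
      S.filter (fun x : Fin n => (x : ℕ) < p) ∪ Finset.univ.filter (fun x : Fin n => (x : ℕ) = p) := by
    intro x hx
    simp only [Finset.mem_filter, Finset.mem_union, Finset.mem_univ, true_and] at hx ⊢
    have := hx.1
    rcases Nat.lt_succ_iff_lt_or_eq.mp hx.2 with h | h
    · exact Or.inl ⟨this, h⟩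
    · exact Or.inr h
  have h2 : (Finset.univ.filter (fun x : Fin n => (x : ℕ) = p)).card ≤ 1 := by
    rw [Finset.card_le_one]
    intro a ha b hb
    simp only [Finset.mem_filter, Finset.mem_univ, true_and] at ha hb
    exact Fin.ext (by omega)
  have h3 := Finset.card_le_card h
  have h4 := Finset.card_union_le (S.filter (fun x : Fin n => (x : ℕ) < p))
    (Finset.univ.filter (fun x : Fin n => (x : ℕ) = p))
  omega

lemma cnt_mix {n : ℕ} (A B : Finset (Fin n)) {p r : ℕ} (h : r ≤ p) :
    cnt (mix p A B) r = cnt A r := by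
  unfold cnt mix
  congr 1
  ext x
  simp only [Finset.mem_filter, Finset.mem_union]
  constructor
  · rintro ⟨h1 | h1, h2⟩
    · exact ⟨h1.1, h2⟩
    · omega
  · rintro ⟨h1, h2⟩
    exact ⟨Or.inl ⟨h1, by omega⟩, h2⟩

lemma mix_mix {n : ℕ} (A B : Finset (Fin n)) (p : ℕ) :
    mix p (mix p A B) (mix p B A) = A := by
  ext x
  simp only [mix, Finset.mem_filter, Finset.mem_union]
  tauto

lemma card_mix {n : ℕ} (A B : Finset (Fin n)) (p : ℕ) :
    (mix p A B).card + cnt B p = cnt A p + B.card := by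
  have h1 : (mix p A B).card = cnt A p + (B.filter (fun x : Fin n => ¬ (x : ℕ) < p)).card := by
    unfold mix cnt
    apply Finset.card_union_of_disjoint
    rw [Finset.disjoint_left]
    intro x hx hy
    simp only [Finset.mem_filter] at hx hy
    exact hy.2 hx.2
  have h2 := Finset.card_filter_add_card_filter_not (s := B) (fun x : Fin n => (x : ℕ) < p)
  unfold cnt at *
  omega

open Classical in
def cut {n : ℕ} (I J : Finset (Fin n)) : ℕ :=
  if h : ∃ p, cnt J p < cnt I p then Nat.find h else 0

lemma cut_spec {n : ℕ} {I J : Finset (Fin n)} (h : ∃ p, cnt J p < cnt I p) :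
    cnt I (cut I J) = cnt J (cut I J) + 1 ∧ ∀ r < cut I J, cnt I r ≤ cnt J r := by
  classical
  have hc : cut I J = Nat.find h := by
    unfold cut
    rw [dif_pos h]
  have h1 := Nat.find_spec h
  have h2 : ∀ r < cut I J, cnt I r ≤ cnt J r := by
    intro r hr
    rw [hc] at hr
    have := Nat.find_min h hr
    omega
  refine ⟨?_, h2⟩
  rw [← hc] at h1
  rcases hcc : cut I J with _ | m
  · rw [hcc, cnt_zero, cnt_zero] at h1
    omega
  · rw [hcc] at h1 h2
    have h3 := h2 m (by omega)
    have h4 := cnt_succ_le I m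
    have h5 := cnt_mono J (show m ≤ m + 1 by omega)
    omega

lemma cut_eq {n : ℕ} {I J : Finset (Fin n)} {c : ℕ} (h : cnt J c < cnt I c)
    (h2 : ∀ r < c, cnt I r ≤ cnt J r) : cut I J = c := by
  have h3 := cut_spec ⟨c, h⟩
  rcases lt_trichotomy (cut I J) c with h4 | h4 | h4
  · have := h2 _ h4
    omega
  · exact h4
  · have := h3.2 _ h4
    omega

lemma cut_mix {n : ℕ} {I J : Finset (Fin n)} (h : ∃ p, cnt J p < cnt I p) :
    cut (mix (cut I J) I J) (mix (cut I J) J I) = cut I J := by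
  have hs := cut_spec h
  apply cut_eq
  · rw [cnt_mix _ _ le_rfl, cnt_mix _ _ le_rfl]
    omega
  · intro r hr
    rw [cnt_mix _ _ hr.le, cnt_mix _ _ hr.le]
    exact hs.2 r hr

open Classical in
def goodSet (n i j : ℕ) : Finset (Finset (Fin n) × Finset (Fin n)) :=
  (Finset.univ.powersetCard i ×ˢ Finset.univ.powersetCard j).filter (fun x => Good x.1 x.2)

lemma mem_goodSet {n i j : ℕ} {x : Finset (Fin n) × Finset (Fin n)} :
    x ∈ goodSet n i j ↔ (x.1.card = i ∧ x.2.card = j) ∧ Good x.1 x.2 := by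
  simp [goodSet, Finset.mem_powersetCard]

open Classical in
lemma card_goodSet (n i j : ℕ) (hi : 1 ≤ i) (hij : i < j) :
    ((goodSet n i j).card : ℤ) =
      (n.choose i : ℤ) * n.choose j - (n.choose (i - 1) : ℤ) * n.choose (j + 1) := by
  have h1 := Finset.card_filter_add_card_filter_not
    (s := (Finset.univ : Finset (Fin n)).powersetCard i ×ˢ
      (Finset.univ : Finset (Fin n)).powersetCard j) (fun x => Good x.1 x.2)
  have h2 : (((Finset.univ : Finset (Fin n)).powersetCard i ×ˢ
      (Finset.univ : Finset (Fin n)).powersetCard j).filter (fun x => ¬ Good x.1 x.2)).card =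
      ((Finset.univ : Finset (Fin n)).powersetCard (j + 1) ×ˢ
      (Finset.univ : Finset (Fin n)).powersetCard (i - 1)).card := by
    apply Finset.card_nbij'
      (i := fun x => (mix (cut x.1 x.2) x.1 x.2, mix (cut x.1 x.2) x.2 x.1))
      (j := fun x => (mix (cut x.1 x.2) x.1 x.2, mix (cut x.1 x.2) x.2 x.1))
    · intro x hx
      simp only [Finset.coe_filter, Finset.mem_product, Finset.mem_powersetCard,
        Finset.subset_univ, true_and, Set.mem_ofPred_eq, Good, not_forall, not_le] at hx
      have hs := cut_spec hx.2
      have e1 := card_mix x.1 x.2 (cut x.1 x.2)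
      have e2 := card_mix x.2 x.1 (cut x.1 x.2)
      simp only [Finset.coe_product, Set.mem_prod, Finset.mem_coe, Finset.mem_powersetCard,
        Finset.subset_univ, true_and]
      omega
    · intro x hx
      simp only [Finset.coe_product, Set.mem_prod, Finset.mem_coe, Finset.mem_powersetCard,
        Finset.subset_univ, true_and] at hx
      have hex : ∃ p, cnt x.2 p < cnt x.1 p := ⟨n, by rw [cnt_top, cnt_top]; omega⟩
      have hs := cut_spec hex
      have e1 := card_mix x.1 x.2 (cut x.1 x.2)
      have e2 := card_mix x.2 x.1 (cut x.1 x.2)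
      simp only [Finset.coe_filter, Finset.mem_product, Finset.mem_powersetCard,
        Finset.subset_univ, true_and, Set.mem_ofPred_eq, Good, not_forall, not_le]
      refine ⟨by omega, cut x.1 x.2, ?_⟩
      rw [cnt_mix _ _ le_rfl, cnt_mix _ _ le_rfl]
      omega
    · intro x hx
      simp only [Finset.coe_filter, Finset.mem_product, Finset.mem_powersetCard,
        Finset.subset_univ, true_and, Set.mem_ofPred_eq, Good, not_forall, not_le] at hx
      simp only [cut_mix hx.2, mix_mix]
    · intro x hx
      simp only [Finset.coe_product, Set.mem_prod, Finset.mem_coe, Finset.mem_powersetCard,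
        Finset.subset_univ, true_and] at hx
      have hex : ∃ p, cnt x.2 p < cnt x.1 p := ⟨n, by rw [cnt_top, cnt_top]; omega⟩
      simp only [cut_mix hex, mix_mix]
  rw [h2] at h1
  simp only [Finset.card_product, Finset.card_powersetCard, Finset.card_univ,
    Fintype.card_fin] at h1
  have h3 : (goodSet n i j).card + n.choose (j + 1) * n.choose (i - 1) =
    n.choose i * n.choose j := h1
  zify at h3
  linarith


structure IsM {n : ℕ} (I J : Finset (Fin n)) (M : Finset (Fin n × Fin n)) : Prop where
  lt : ∀ a b, (a, b) ∈ M → a < b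
  fst : ∀ a b, (a, b) ∈ M → a ∈ J ∧ a ∉ I
  snd : ∀ a b, (a, b) ∈ M → b ∈ I ∧ b ∉ J
  ex : ∀ b, b ∈ I → b ∉ J → ∃ a, (a, b) ∈ M
  inl : ∀ a b c, (a, b) ∈ M → a < c → c < b → c ∈ J → c ∉ I → ∃ e, (c, e) ∈ M ∧ e < b
  inr : ∀ a b a' b', (a, b) ∈ M → (a', b') ∈ M → a < b' → b' < b → a < a'
  inj1 : ∀ a b b', (a, b) ∈ M → (a, b') ∈ M → b = b'
  inj2 : ∀ a a' b, (a, b) ∈ M → (a', b) ∈ M → a = a'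

lemma IsM.mate_unique {n : ℕ} {I J : Finset (Fin n)} {M M' : Finset (Fin n × Fin n)}
    (h : IsM I J M) (h' : IsM I J M') :
    ∀ m : ℕ, ∀ b a a' : Fin n, (b : ℕ) = m → (a, b) ∈ M → (a', b) ∈ M' → a = a' := by
  intro m
  induction m using Nat.strong_induction_on with
  | _ m ih =>
    intro b a a' hb ha ha'
    rcases lt_trichotomy a a' with hlt | heq | hlt
    · exfalso
      have hf := h'.fst _ _ ha'
      obtain ⟨e, he, heb⟩ := h.inl a b a' ha hlt (h'.lt _ _ ha') hf.1 hf.2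
      have hs := h.snd _ _ he
      obtain ⟨c, hc⟩ := h'.ex e hs.1 hs.2
      have h1 := h'.inr a' b c e ha' hc (h.lt _ _ he) heb
      have h2 := ih e (by omega) e a' c rfl he hc
      omega
    · exact heq
    · exfalso
      have hf := h.fst _ _ ha
      obtain ⟨e, he, heb⟩ := h'.inl a' b a ha' hlt (h.lt _ _ ha) hf.1 hf.2
      have hs := h'.snd _ _ he
      obtain ⟨c, hc⟩ := h.ex e hs.1 hs.2
      have h1 := h.inr a b c e ha hc (h'.lt _ _ he) heb
      have h2 := ih e (by omega) e c a rfl hc he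
      omega

lemma IsM.unique {n : ℕ} {I J : Finset (Fin n)} {M M' : Finset (Fin n × Fin n)}
    (h : IsM I J M) (h' : IsM I J M') : M = M' := by
  ext ⟨a, b⟩
  constructor
  · intro hm
    obtain ⟨a', ha'⟩ := h'.ex b (h.snd _ _ hm).1 (h.snd _ _ hm).2
    rw [h.mate_unique h' _ b a a' rfl hm ha']
    exact ha'
  · intro hm
    obtain ⟨a', ha'⟩ := h.ex b (h'.snd _ _ hm).1 (h'.snd _ _ hm).2
    rw [← h.mate_unique h' _ b a' a rfl ha' hm]
    exact ha'

lemma IsM.good {n : ℕ} {I J : Finset (Fin n)} {M : Finset (Fin n × Fin n)}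
    (h : IsM I J M) : Good I J := by
  classical
  intro p
  have hex : ∀ b : Fin n, ∃ a : Fin n, b ∈ I → b ∉ J → (a, b) ∈ M := by
    intro b
    by_cases hb : b ∈ I ∧ b ∉ J
    · obtain ⟨a, ha⟩ := h.ex b hb.1 hb.2
      exact ⟨a, fun _ _ => ha⟩
    · exact ⟨b, fun h1 h2 => absurd ⟨h1, h2⟩ hb⟩
  choose f hf using hex
  unfold cnt
  apply Finset.card_le_card_of_injOn (fun b => if b ∈ J then b else f b)
  · intro b hb
    simp only [Finset.coe_filter, Set.mem_ofPred_eq] at hb ⊢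
    by_cases hbJ : b ∈ J
    · simp only [hbJ, if_true]
      exact ⟨trivial, hb.2⟩
    · simp only [hbJ, if_false]
      have hm := hf b hb.1 hbJ
      have := h.lt _ _ hm
      exact ⟨(h.fst _ _ hm).1, by omega⟩
  · intro b hb b' hb' heq
    simp only [Finset.coe_filter, Set.mem_ofPred_eq] at hb hb'
    by_cases hbJ : b ∈ J <;> by_cases hbJ' : b' ∈ J
    · simpa [hbJ, hbJ'] using heq
    · simp only [hbJ, hbJ', if_true, if_false] at heq
      have := (h.fst _ _ (hf b' hb'.1 hbJ')).2
      rw [← heq] at this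
      exact absurd hb.1 this
    · simp only [hbJ, hbJ', if_true, if_false] at heq
      have := (h.fst _ _ (hf b hb.1 hbJ)).2
      rw [heq] at this
      exact absurd hb'.1 this
    · simp only [hbJ, hbJ', if_false] at heq
      have h1 := hf b hb.1 hbJ
      have h2 := hf b' hb'.1 hbJ'
      rw [heq] at h1
      exact h.inj1 _ _ _ h1 h2

lemma cnt_erase {n : ℕ} (S : Finset (Fin n)) (x : Fin n) (hx : x ∈ S) (p : ℕ) :
    cnt (S.erase x) p + (if (x : ℕ) < p then 1 else 0) = cnt S p := by
  unfold cnt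
  rw [Finset.filter_erase]
  split_ifs with h
  · rw [Finset.card_erase_add_one]
    simp [hx, h]
  · rw [Finset.erase_eq_of_notMem]
    · simp
    · simp [h]

lemma cnt_split {n : ℕ} (I J : Finset (Fin n)) (p : ℕ) :
    cnt I p = cnt (I ∩ J) p + cnt (I \ J) p := by
  classical
  unfold cnt
  rw [← Finset.card_union_of_disjoint]
  · congr 1
    ext x
    simp only [Finset.mem_filter, Finset.mem_union, Finset.mem_inter, Finset.mem_sdiff]
    tauto
  · rw [Finset.disjoint_left]
    intro x
    simp only [Finset.mem_filter, Finset.mem_inter, Finset.mem_sdiff]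
    tauto

lemma exists_isM {n : ℕ} : ∀ (m : ℕ) (I J : Finset (Fin n)), (I \ J).card = m → Good I J →
    ∃ M, IsM I J M := by
  classical
  intro m
  induction m with
  | zero =>
    intro I J hc _
    refine ⟨∅, ?_⟩
    have hsub : ∀ b, b ∈ I → b ∈ J := by
      intro b hb
      exact (Finset.sdiff_eq_empty_iff_subset.mp (Finset.card_eq_zero.mp hc)) hb
    constructor <;> simp
    exact hsub
  | succ m ih =>
    intro I J hc hg
    have hne : (I \ J).Nonempty := Finset.card_pos.mp (by omega)
    obtain ⟨b, hb, hbmin⟩ := Finset.exists_min_image (I \ J) (fun x => x) hne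
    have hb0 := Finset.mem_sdiff.mp hb
    have hex : ((J \ I).filter (fun x => x < b)).Nonempty := by
      have h1 := hg ((b : ℕ) + 1)
      rw [cnt_split I J, cnt_split J I, Finset.inter_comm J I] at h1
      have h2 : 0 < cnt (I \ J) ((b : ℕ) + 1) := by
        apply Finset.card_pos.mpr
        exact ⟨b, by simp only [Finset.mem_filter]; exact ⟨hb, by omega⟩⟩
      have h3 : 0 < cnt (J \ I) ((b : ℕ) + 1) := by omega
      obtain ⟨x, hx⟩ := Finset.card_pos.mp h3
      simp only [Finset.mem_filter] at hx
      refine ⟨x, ?_⟩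
      simp only [Finset.mem_filter]
      refine ⟨hx.1, ?_⟩
      have h4 : x ≠ b := by
        rintro rfl
        exact hb0.2 (Finset.mem_sdiff.mp hx.1).1
      have h5 : (x : ℕ) ≠ b := fun h => h4 (Fin.ext h)
      exact Fin.lt_def.mpr (by omega)
    obtain ⟨a, ha, hamax⟩ := Finset.exists_max_image _ (fun x => x) hex
    simp only [Finset.mem_filter, Finset.mem_sdiff] at ha hamax hbmin
    have hJ1 : a ∈ J := ha.1.1
    have hg1 : Good (I.erase b) (J.erase a) := by
      intro p
      have e1 := cnt_erase I b hb0.1 p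
      have e2 := cnt_erase J a hJ1 p
      have e3 := hg p
      by_cases hap : (a : ℕ) < p
      · by_cases hbp : (b : ℕ) < p
        · simp only [hap, hbp, if_true] at e1 e2
          omega
        · simp only [hap, hbp, if_true, if_false] at e1 e2
          have e4 : cnt (I \ J) p = 0 := by
            apply Finset.card_eq_zero.mpr
            apply Finset.filter_eq_empty_iff.mpr
            intro x hx
            have := hbmin x (Finset.mem_sdiff.mp hx)
            omega
          have e5 : 0 < cnt (J \ I) p := by
            apply Finset.card_pos.mpr
            exact ⟨a, by simp only [Finset.mem_filter, Finset.mem_sdiff]; exact ⟨ha.1, hap⟩⟩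
          have e6 := cnt_split I J p
          have e7 := cnt_split J I p
          rw [Finset.inter_comm J I] at e7
          omega
      · have hbp : ¬ (b : ℕ) < p := by
          have := ha.2
          omega
        simp only [hap, hbp, if_false] at e1 e2
        omega
    have hc1 : (I.erase b \ J.erase a).card = m := by
      have : I.erase b \ J.erase a = (I \ J).erase b := by
        ext x
        simp only [Finset.mem_sdiff, Finset.mem_erase]
        constructor
        · rintro ⟨⟨h1, h2⟩, h3⟩
          refine ⟨h1, h2, fun h4 => h3 ⟨?_, h4⟩⟩
          rintro rfl
          exact ha.1.2 h2
        · rintro ⟨h1, h2, h3⟩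
          exact ⟨⟨h1, h2⟩, fun h4 => h3 h4.2⟩
      rw [this, Finset.card_erase_of_mem hb]
      omega
    obtain ⟨M, hM⟩ := ih _ _ hc1 hg1
    have f1 : ∀ x y, (x, y) ∈ M → x ≠ a ∧ x ∈ J ∧ x ∉ I := by
      intro x y h
      have h1 := hM.fst _ _ h
      simp only [Finset.mem_erase] at h1
      refine ⟨h1.1.1, h1.1.2, fun h2 => h1.2 ⟨?_, h2⟩⟩
      rintro rfl
      exact hb0.2 h1.1.2
    have f2 : ∀ x y, (x, y) ∈ M → y ≠ b ∧ y ∈ I ∧ y ∉ J := by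
      intro x y h
      have h1 := hM.snd _ _ h
      simp only [Finset.mem_erase] at h1
      refine ⟨h1.1.1, h1.1.2, fun h2 => h1.2 ⟨?_, h2⟩⟩
      rintro rfl
      exact ha.1.2 h1.1.2
    refine ⟨insert (a, b) M, ?_⟩
    constructor
    · intro x y h
      rcases Finset.mem_insert.mp h with h | h
      · cases h
        exact ha.2
      · exact hM.lt _ _ h
    · intro x y h
      rcases Finset.mem_insert.mp h with h | h
      · cases h
        exact ha.1
      · exact (f1 _ _ h).2
    · intro x y h
      rcases Finset.mem_insert.mp h with h | h
      · cases h
        exact hb0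
      · exact (f2 _ _ h).2
    · intro y h1 h2
      by_cases hy : y = b
      · subst hy
        exact ⟨a, Finset.mem_insert_self _ _⟩
      · obtain ⟨x, hx⟩ := hM.ex y (by simp [hy, h1]) (by simp [h2])
        exact ⟨x, Finset.mem_insert_of_mem hx⟩
    · intro x y c h h1 h2 h3 h4
      rcases Finset.mem_insert.mp h with h | h
      · cases h
        have := hamax c ⟨⟨h3, h4⟩, h2⟩
        omega
      · by_cases hca : c = a
        · have h5 := f2 _ _ h
          subst hca
          refine ⟨b, Finset.mem_insert_self _ _, ?_⟩
          have h6 := hbmin y h5.2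
          exact lt_of_le_of_ne h6 (Ne.symm h5.1)
        · obtain ⟨e, he, hey⟩ := hM.inl x y c h h1 h2 (by simp [hca, h3]) (by simp [h4])
          exact ⟨e, Finset.mem_insert_of_mem he, hey⟩
    · intro x y x' y' h h' h1 h2
      rcases Finset.mem_insert.mp h with h | h
      · cases h
        rcases Finset.mem_insert.mp h' with h' | h'
        · cases h'
          exact absurd h2 (lt_irrefl _)
        · have := hbmin y' (f2 _ _ h').2
          omega
      · rcases Finset.mem_insert.mp h' with h' | h'
        · cases h'
          have h5 := f1 _ _ h
          have h6 := hamax x ⟨h5.2, h1⟩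
          exact lt_of_le_of_ne h6 h5.1
        · exact hM.inr _ _ _ _ h h' h1 h2
    · intro x y y' h h'
      rcases Finset.mem_insert.mp h with h | h <;> rcases Finset.mem_insert.mp h' with h' | h'
      · cases h; cases h'; rfl
      · cases h
        exact absurd rfl (f1 _ _ h').1
      · cases h'
        exact absurd rfl (f1 _ _ h).1
      · exact hM.inj1 _ _ _ h h'
    · intro x x' y h h'
      rcases Finset.mem_insert.mp h with h | h <;> rcases Finset.mem_insert.mp h' with h' | h'
      · cases h; cases h'; rfl
      · cases h
        exact absurd rfl (f2 _ _ h').1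
      · cases h'
        exact absurd rfl (f2 _ _ h).1
      · exact hM.inj2 _ _ _ h h'


lemma arith_step (r p q c a b : ℕ) (hpq : p < q) (hab : a < b) (h1 : r ≠ p) (h2 : r ≠ q)
    (h3 : c ≠ a) (h4 : c ≠ b) :
    (if p < r ∧ c < b then 1 else 0) + (if q < r ∧ c < a then 1 else 0)
      + (if r < p ∧ b < c then 1 else 0) + (if r < q ∧ a < c then 1 else 0) =
    (if p < r ∧ c < a then 1 else 0) + (if q < r ∧ c < b then 1 else 0)
      + (if r < p ∧ a < c then 1 else 0) + (if r < q ∧ b < c then 1 else 0)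
      + 2 * (if p < r ∧ r < q ∧ a < c ∧ c < b then 1 else 0) := by
  rcases lt_or_gt_of_ne h1 with h1 | h1 <;> rcases lt_or_gt_of_ne h2 with h2 | h2 <;>
  rcases lt_or_gt_of_ne h3 with h3 | h3 <;> rcases lt_or_gt_of_ne h4 with h4 | h4 <;>
  first
  | omega
  | simp [h1, h2, h3, h4, h1.not_gt, h2.not_gt, h3.not_gt, h4.not_gt]

lemma sum_split2 {n : ℕ} (F : Fin n → Fin n → ℕ) (p q : Fin n) (hpq : p ≠ q) :
    ∑ x, ∑ y, F x y = (F p p + F p q + F q p + F q q)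
      + ∑ r ∈ (Finset.univ.erase p).erase q, (F p r + F q r + F r p + F r q)
      + ∑ x ∈ (Finset.univ.erase p).erase q, ∑ y ∈ (Finset.univ.erase p).erase q, F x y := by
  have key : ∀ g : Fin n → ℕ, ∑ x, g x = g p + g q + ∑ r ∈ (Finset.univ.erase p).erase q, g r := by
    intro g
    rw [← Finset.add_sum_erase Finset.univ g (Finset.mem_univ p),
      ← Finset.add_sum_erase (Finset.univ.erase p) g (a := q) (by simp [hpq.symm])]
    ring
  rw [key]
  simp only [key (F p), key (F q)]
  have : ∀ x, ∑ y, F x y = F x p + F x q + ∑ r ∈ (Finset.univ.erase p).erase q, F x r :=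
    fun x => key (F x)
  simp only [this, Finset.sum_add_distrib]
  ring

lemma invCount_eq_sum {n : ℕ} (u : Equiv.Perm (Fin n)) :
    invCount u = ∑ x : Fin n, ∑ y : Fin n, if (x : ℕ) < y ∧ ((u y : Fin n) : ℕ) < u x then 1 else 0 := by
  unfold invCount
  rw [Finset.card_filter, ← Finset.univ_product_univ, Finset.sum_product]
  rfl

lemma invCount_mul_swap {n : ℕ} (u : Equiv.Perm (Fin n)) (p q : Fin n) (hpq : p < q)
    (hu : u p < u q) :
    invCount (u * Equiv.swap p q) = invCount u + 1 +
      2 * ∑ r ∈ (Finset.univ.erase p).erase q,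
        (if (p : ℕ) < r ∧ (r : ℕ) < q ∧ (u p : ℕ) < u r ∧ (u r : ℕ) < u q then 1 else 0) := by
  rw [invCount_eq_sum, invCount_eq_sum, sum_split2 _ p q hpq.ne, sum_split2 _ p q hpq.ne]
  have ep : (u * Equiv.swap p q) p = u q := by simp
  have eq : (u * Equiv.swap p q) q = u p := by simp
  have er : ∀ r ∈ (Finset.univ.erase p).erase q, (u * Equiv.swap p q) r = u r := by
    intro r hr
    simp only [Finset.mem_erase, Finset.mem_univ, and_true] at hr
    rw [Equiv.Perm.mul_apply, Equiv.swap_apply_of_ne_of_ne hr.2 hr.1]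
  have h1 : ∑ x ∈ (Finset.univ.erase p).erase q, ∑ y ∈ (Finset.univ.erase p).erase q,
      (if (x : ℕ) < y ∧ (((u * Equiv.swap p q) y : Fin n) : ℕ) < (u * Equiv.swap p q) x
        then 1 else 0) =
      ∑ x ∈ (Finset.univ.erase p).erase q, ∑ y ∈ (Finset.univ.erase p).erase q,
      (if (x : ℕ) < y ∧ ((u y : Fin n) : ℕ) < u x then 1 else 0) := by
    apply Finset.sum_congr rfl
    intro x hx
    apply Finset.sum_congr rfl
    intro y hy
    rw [er x hx, er y hy]
  rw [h1, ep, eq]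
  have hpq' : (p : ℕ) < q := hpq
  have hu' : (u p : ℕ) < u q := hu
  have h2 : ∑ r ∈ (Finset.univ.erase p).erase q,
      ((if (p : ℕ) < r ∧ (((u * Equiv.swap p q) r : Fin n) : ℕ) < u q then 1 else 0)
      + (if (q : ℕ) < r ∧ (((u * Equiv.swap p q) r : Fin n) : ℕ) < u p then 1 else 0)
      + (if (r : ℕ) < p ∧ (u q : ℕ) < (u * Equiv.swap p q) r then 1 else 0)
      + (if (r : ℕ) < q ∧ (u p : ℕ) < (u * Equiv.swap p q) r then 1 else 0)) =
      ∑ r ∈ (Finset.univ.erase p).erase q,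
      ((if (p : ℕ) < r ∧ ((u r : Fin n) : ℕ) < u p then 1 else 0)
      + (if (q : ℕ) < r ∧ ((u r : Fin n) : ℕ) < u q then 1 else 0)
      + (if (r : ℕ) < p ∧ (u p : ℕ) < u r then 1 else 0)
      + (if (r : ℕ) < q ∧ (u q : ℕ) < u r then 1 else 0)) +
      2 * ∑ r ∈ (Finset.univ.erase p).erase q,
        (if (p : ℕ) < r ∧ (r : ℕ) < q ∧ (u p : ℕ) < u r ∧ (u r : ℕ) < u q then 1 else 0) := by
    rw [Finset.mul_sum, ← Finset.sum_add_distrib]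
    apply Finset.sum_congr rfl
    intro r hr
    rw [er r hr]
    simp only [Finset.mem_erase, Finset.mem_univ, and_true] at hr
    apply arith_step _ _ _ _ _ _ hpq' hu'
    · exact fun h => hr.2 (Fin.ext h)
    · exact fun h => hr.1 (Fin.ext h)
    · exact fun h => hr.2 (u.injective (Fin.ext h))
    · exact fun h => hr.1 (u.injective (Fin.ext h))
  rw [h2]
  simp only [lt_irrefl, false_and, hpq', hu', hpq'.not_gt, hu'.not_gt, and_false, and_true,
    if_true, if_false]
  ring

lemma ap_inv {n : ℕ} (w : Equiv.Perm (Fin n)) (x : Fin n) : w (w⁻¹ x) = x := by simp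

lemma inv_ap {n : ℕ} (w : Equiv.Perm (Fin n)) (x : Fin n) : w⁻¹ (w x) = x := by simp

lemma swap_mul_eq {n : ℕ} (u : Equiv.Perm (Fin n)) (a b : Fin n) :
    Equiv.swap a b * u = u * Equiv.swap (u⁻¹ a) (u⁻¹ b) := by
  rw [Equiv.mul_swap_eq_swap_mul]
  simp

lemma step_iff {n : ℕ} (u : Equiv.Perm (Fin n)) (a b : Fin n) (hab : a < b) :
    invCount (Equiv.swap a b * u) = invCount u + 1 ↔
      u⁻¹ a < u⁻¹ b ∧ ∀ r, u⁻¹ a < r → r < u⁻¹ b → ¬ (a < u r ∧ u r < b) := by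
  have ha : u (u⁻¹ a) = a := by simp
  have hb : u (u⁻¹ b) = b := by simp
  rcases lt_trichotomy (u⁻¹ a) (u⁻¹ b) with h | h | h
  · rw [swap_mul_eq, invCount_mul_swap u _ _ h (by rw [ha, hb]; exact hab), ha, hb]
    constructor
    · intro h1
      refine ⟨h, ?_⟩
      have h2 : ∑ r ∈ (Finset.univ.erase (u⁻¹ a)).erase (u⁻¹ b),
        (if (u⁻¹ a : ℕ) < r ∧ (r : ℕ) < u⁻¹ b ∧ (a : ℕ) < u r ∧ (u r : ℕ) < b then 1 else 0) = 0 := by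
        omega
      rw [Finset.sum_eq_zero_iff] at h2
      intro r h3 h4 h5
      have h6 := h2 r (Finset.mem_erase.mpr ⟨h4.ne, Finset.mem_erase.mpr ⟨h3.ne', Finset.mem_univ _⟩⟩)
      rw [if_pos ⟨h3, h4, h5.1, h5.2⟩] at h6
      omega
    · rintro ⟨_, h1⟩
      rw [Finset.sum_eq_zero]
      · rfl
      · intro r _
        apply if_neg
        rintro ⟨h3, h4, h5, h6⟩
        exact h1 r h3 h4 ⟨h5, h6⟩
  · have := u⁻¹.injective h
    omega
  · constructor
    · intro h1
      exfalso
      have h2 := invCount_mul_swap (Equiv.swap a b * u) (u⁻¹ b) (u⁻¹ a) h (by simpa using hab)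
      have h3 : Equiv.swap a b * u * Equiv.swap (u⁻¹ b) (u⁻¹ a) = u := by
        rw [Equiv.swap_comm (u⁻¹ b), mul_assoc, ← swap_mul_eq, ← mul_assoc, Equiv.swap_mul_self,
          one_mul]
      rw [h3] at h2
      omega
    · rintro ⟨h1, _⟩
      exact absurd h (not_lt.mpr h1.le)


lemma orth_ne {n d : ℕ} {t : Fin d → Fin n × Fin n} (ht : IsOrthocell t) {k l : Fin d}
    (h : k ≠ l) : (t k).1 ≠ (t l).1 ∧ (t k).1 ≠ (t l).2 ∧ (t k).2 ≠ (t l).1 ∧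
      (t k).2 ≠ (t l).2 := by
  have h1 := ht.2 k l h
  rw [Set.eq_empty_iff_forall_notMem] at h1
  have h2 := h1 (t k).1
  have h3 := h1 (t k).2
  simp only [Set.mem_inter_iff, Set.mem_insert_iff, Set.mem_singleton_iff, true_or, or_true,
    true_and, not_or] at h2 h3
  exact ⟨h2.1, h2.2, h3.1, h3.2⟩

lemma list_other {n d : ℕ} (t : Fin d → Fin n × Fin n) (x : Fin n) :
    ∀ l : List (Fin d), (∀ k ∈ l, x ≠ (t k).1 ∧ x ≠ (t k).2) →
      (l.map fun k => Equiv.swap (t k).1 (t k).2).prod x = x := by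
  intro l
  induction l with
  | nil => intro _; simp
  | cons k l ih =>
    intro h
    simp only [List.map_cons, List.prod_cons, Equiv.Perm.mul_apply]
    rw [ih (fun k' hk' => h k' (List.mem_cons_of_mem _ hk'))]
    have := h k List.mem_cons_self
    exact Equiv.swap_apply_of_ne_of_ne this.1 this.2

lemma list_mem {n d : ℕ} {t : Fin d → Fin n × Fin n} (ht : IsOrthocell t) (k : Fin d) :
    ∀ l : List (Fin d), l.Nodup → k ∈ l →
      (l.map fun k => Equiv.swap (t k).1 (t k).2).prod (t k).1 = (t k).2 ∧
      (l.map fun k => Equiv.swap (t k).1 (t k).2).prod (t k).2 = (t k).1 := by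
  intro l
  induction l with
  | nil => intro _ h; simp at h
  | cons m l ih =>
    intro hnd hk
    simp only [List.map_cons, List.prod_cons, Equiv.Perm.mul_apply]
    rw [List.nodup_cons] at hnd
    by_cases hkm : k = m
    · subst hkm
      have h1 : ∀ x, (x = (t k).1 ∨ x = (t k).2) →
          (l.map fun k => Equiv.swap (t k).1 (t k).2).prod x = x := by
        intro x hx
        apply list_other
        intro k' hk'
        have hne : k ≠ k' := by
          rintro rfl
          exact hnd.1 hk'
        have := orth_ne ht hne
        rcases hx with rfl | rfl
        · exact ⟨this.1, this.2.1⟩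
        · exact ⟨this.2.2.1, this.2.2.2⟩
      rw [h1 _ (Or.inl rfl), h1 _ (Or.inr rfl)]
      simp
    · have hk' : k ∈ l := by
        rcases List.mem_cons.mp hk with h | h
        · exact absurd h hkm
        · exact h
      have h1 := ih hnd.2 hk'
      have h2 := orth_ne ht hkm
      rw [h1.1, h1.2]
      exact ⟨Equiv.swap_apply_of_ne_of_ne h2.2.2.1 h2.2.2.2,
        Equiv.swap_apply_of_ne_of_ne h2.1 h2.2.1⟩

lemma sL_other {n d : ℕ} (t : Fin d → Fin n × Fin n) (L : Finset (Fin d)) (x : Fin n)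
    (h : ∀ k ∈ L, x ≠ (t k).1 ∧ x ≠ (t k).2) : sL t L x = x := by
  apply list_other
  intro k hk
  exact h k (by simpa using hk)

lemma sL_fst {n d : ℕ} {t : Fin d → Fin n × Fin n} (ht : IsOrthocell t) {L : Finset (Fin d)}
    {k : Fin d} (hk : k ∈ L) : sL t L (t k).1 = (t k).2 :=
  (list_mem ht k _ (Finset.sort_nodup _ _) (by simpa using hk)).1

lemma sL_snd {n d : ℕ} {t : Fin d → Fin n × Fin n} (ht : IsOrthocell t) {L : Finset (Fin d)}
    {k : Fin d} (hk : k ∈ L) : sL t L (t k).2 = (t k).1 :=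
  (list_mem ht k _ (Finset.sort_nodup _ _) (by simpa using hk)).2

lemma sL_fst' {n d : ℕ} {t : Fin d → Fin n × Fin n} (ht : IsOrthocell t) {L : Finset (Fin d)}
    {k : Fin d} (hk : k ∉ L) : sL t L (t k).1 = (t k).1 := by
  apply sL_other
  intro l hl
  have := orth_ne ht (show k ≠ l by rintro rfl; exact hk hl)
  exact ⟨this.1, this.2.1⟩

lemma sL_snd' {n d : ℕ} {t : Fin d → Fin n × Fin n} (ht : IsOrthocell t) {L : Finset (Fin d)}
    {k : Fin d} (hk : k ∉ L) : sL t L (t k).2 = (t k).2 := by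
  apply sL_other
  intro l hl
  have := orth_ne ht (show k ≠ l by rintro rfl; exact hk hl)
  exact ⟨this.2.2.1, this.2.2.2⟩

lemma sL_invol {n d : ℕ} {t : Fin d → Fin n × Fin n} (ht : IsOrthocell t) (L : Finset (Fin d))
    (x : Fin n) : sL t L (sL t L x) = x := by
  by_cases h : ∀ k ∈ L, x ≠ (t k).1 ∧ x ≠ (t k).2
  · rw [sL_other t L x h, sL_other t L x h]
  · push Not at h
    obtain ⟨k, hk, h⟩ := h
    by_cases h1 : x = (t k).1
    · rw [h1, sL_fst ht hk, sL_snd ht hk]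
    · rw [h h1, sL_snd ht hk, sL_fst ht hk]

lemma sL_inv {n d : ℕ} {t : Fin d → Fin n × Fin n} (ht : IsOrthocell t) (L : Finset (Fin d)) :
    (sL t L)⁻¹ = sL t L := by
  rw [inv_eq_iff_mul_eq_one]
  ext x
  rw [Equiv.Perm.mul_apply, sL_invol ht]
  rfl

lemma sL_empty {n d : ℕ} (t : Fin d → Fin n × Fin n) : sL t ∅ = 1 := by
  simp [sL]

lemma sL_insert {n d : ℕ} {t : Fin d → Fin n × Fin n} (ht : IsOrthocell t) {L : Finset (Fin d)}
    {k : Fin d} (hk : k ∉ L) :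
    sL t (insert k L) = Equiv.swap (t k).1 (t k).2 * sL t L := by
  apply Equiv.ext
  intro x
  rw [Equiv.Perm.mul_apply]
  by_cases hx : x = (t k).1
  · rw [hx, sL_fst ht (Finset.mem_insert_self _ _), sL_fst' ht hk]
    simp
  by_cases hx' : x = (t k).2
  · rw [hx', sL_snd ht (Finset.mem_insert_self _ _), sL_snd' ht hk]
    simp
  by_cases h : ∀ l ∈ L, x ≠ (t l).1 ∧ x ≠ (t l).2
  · rw [sL_other t L x h, Equiv.swap_apply_of_ne_of_ne hx hx']
    apply sL_other
    intro l hl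
    rcases Finset.mem_insert.mp hl with rfl | hl
    · exact ⟨hx, hx'⟩
    · exact h l hl
  · push Not at h
    obtain ⟨l, hl, h⟩ := h
    have hne := orth_ne ht (show l ≠ k by rintro rfl; exact hk hl)
    by_cases h1 : x = (t l).1
    · rw [h1, sL_fst ht hl, sL_fst ht (Finset.mem_insert_of_mem hl),
        Equiv.swap_apply_of_ne_of_ne hne.2.2.1 hne.2.2.2]
    · rw [h h1, sL_snd ht hl, sL_snd ht (Finset.mem_insert_of_mem hl),
        Equiv.swap_apply_of_ne_of_ne hne.1 hne.2.1]

lemma sL_comp {n d : ℕ} {t : Fin d → Fin n × Fin n} (ht : IsOrthocell t)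
    {d' : ℕ} {t' : Fin d' → Fin n × Fin n} (ht' : IsOrthocell t') (σ : Fin d' ≃ Fin d)
    (hσ : ∀ k, t' k = t (σ k)) (L : Finset (Fin d')) :
    sL t' L = sL t (L.map σ.toEmbedding) := by
  apply Equiv.ext
  intro x
  have hm : ∀ k ∈ L, σ k ∈ L.map σ.toEmbedding := by
    intro k hk
    simpa using hk
  by_cases h : ∀ k ∈ L, x ≠ (t' k).1 ∧ x ≠ (t' k).2
  · rw [sL_other t' L x h, sL_other]
    intro k hk
    obtain ⟨k', hk', rfl⟩ := Finset.mem_map.mp hk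
    have := h k' hk'
    rw [hσ] at this
    exact this
  · push Not at h
    obtain ⟨k, hk, h⟩ := h
    by_cases h1 : x = (t' k).1
    · rw [h1, sL_fst ht' hk, hσ, sL_fst ht (hm k hk)]
    · rw [h h1, sL_snd ht' hk, hσ, sL_snd ht (hm k hk)]


lemma mem_firstSet {n : ℕ} (w : Equiv.Perm (Fin n)) (i : ℕ) (x : Fin n) :
    x ∈ firstSet w i ↔ ((w⁻¹ x : Fin n) : ℕ) < i := by
  unfold firstSet
  simp only [Finset.mem_image, Finset.mem_filter, Finset.mem_univ, true_and]
  constructor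
  · rintro ⟨p, hp, rfl⟩
    rw [inv_ap]
    exact hp
  · intro h
    exact ⟨w⁻¹ x, h, ap_inv w x⟩

lemma mem_firstSet_mul {n d : ℕ} {t : Fin d → Fin n × Fin n} (ht : IsOrthocell t)
    (L : Finset (Fin d)) (w : Equiv.Perm (Fin n)) (i : ℕ) (x : Fin n) :
    x ∈ firstSet (sL t L * w) i ↔ sL t L x ∈ firstSet w i := by
  rw [mem_firstSet, mem_firstSet, mul_inv_rev, sL_inv ht, Equiv.Perm.mul_apply]

lemma mono_step {n d : ℕ} {t : Fin d → Fin n × Fin n} (ht : IsOrthocell t)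
    {w : Equiv.Perm (Fin n)} (hm : Monogressive w t) {L : Finset (Fin d)} {k : Fin d}
    (hk : k ∉ L) :
    invCount (Equiv.swap (t k).1 (t k).2 * (sL t L * w)) = invCount (sL t L * w) + 1 := by
  have h1 := hm (insert k L)
  have h2 := hm L
  rw [sL_insert ht hk, Finset.card_insert_of_notMem hk, mul_assoc] at h1
  omega

lemma mono_facts {n d : ℕ} {t : Fin d → Fin n × Fin n} (ht : IsOrthocell t)
    {w : Equiv.Perm (Fin n)} (hm : Monogressive w t) {L : Finset (Fin d)} {k : Fin d}
    (hk : k ∉ L) :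
    w⁻¹ (t k).1 < w⁻¹ (t k).2 ∧ ∀ r, w⁻¹ (t k).1 < r → r < w⁻¹ (t k).2 →
      ¬ ((t k).1 < sL t L (w r) ∧ sL t L (w r) < (t k).2) := by
  have h := (step_iff _ _ _ (ht.1 k)).mp (mono_step ht hm hk)
  rw [mul_inv_rev, sL_inv ht, Equiv.Perm.mul_apply, Equiv.Perm.mul_apply, sL_fst' ht hk,
    sL_snd' ht hk] at h
  exact h

lemma eff_pos {n d : ℕ} {t : Fin d → Fin n × Fin n} (ht : IsOrthocell t)
    {w : Equiv.Perm (Fin n)} (hm : Monogressive w t) {i : ℕ} (he : Effective w t i) (k : Fin d) :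
    ((w⁻¹ (t k).1 : Fin n) : ℕ) < i ∧ i ≤ ((w⁻¹ (t k).2 : Fin n) : ℕ) := by
  have h1 := (mono_facts ht hm (Finset.notMem_empty k)).1
  have h2 := he k
  rw [mem_firstSet, mem_firstSet] at h2
  rcases h2 with h2 | h2
  · omega
  · omega

lemma mono_between {n d : ℕ} {t : Fin d → Fin n × Fin n} (ht : IsOrthocell t)
    {w : Equiv.Perm (Fin n)} (hm : Monogressive w t) (k : Fin d) (c : Fin n)
    (h1 : (t k).1 < c) (h2 : c < (t k).2) :
    w⁻¹ c < w⁻¹ (t k).1 ∨ w⁻¹ (t k).2 < w⁻¹ c := by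
  have h := (mono_facts ht hm (Finset.notMem_empty k)).2 (w⁻¹ c)
  rw [sL_empty, ap_inv, Equiv.Perm.one_apply] at h
  by_contra hcon
  push Not at hcon
  refine h (lt_of_le_of_ne hcon.1 ?_) (lt_of_le_of_ne hcon.2 ?_) ⟨h1, h2⟩
  · intro h3
    exact h1.ne (w⁻¹.injective h3)
  · intro h3
    exact h2.ne (w⁻¹.injective h3)

lemma mono_nocross {n d : ℕ} {t : Fin d → Fin n × Fin n} (ht : IsOrthocell t)
    {w : Equiv.Perm (Fin n)} (hm : Monogressive w t) {i : ℕ} (he : Effective w t i)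
    (k l : Fin d) (h1 : (t k).1 < (t l).1) (h2 : (t l).1 < (t k).2) :
    ¬ (t k).2 < (t l).2 := by
  intro h3
  have hkl : l ≠ k := by
    rintro rfl
    exact lt_irrefl _ h1
  have e1 := eff_pos ht hm he k
  have e2 := eff_pos ht hm he l
  have h4 := mono_between ht hm k _ h1 h2
  have h5 := (mono_facts ht hm (L := {k}) (k := l) (by simpa using hkl)).2 (w⁻¹ (t k).1)
  rw [ap_inv, sL_fst ht (Finset.mem_singleton_self k)] at h5
  refine h5 ?_ ?_ ⟨h2, h3⟩
  · rcases h4 with h4 | h4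
    · exact h4
    · omega
  · omega

lemma datum_isM {n d : ℕ} {t : Fin d → Fin n × Fin n} (ht : IsOrthocell t)
    {w : Equiv.Perm (Fin n)} (hm : Monogressive w t) {i j : ℕ} (hij : i < j)
    (hi : Effective w t i) (hj : Effective w t j) :
    IsM (firstSet (sL t Finset.univ * w) i) (firstSet w j) (Finset.univ.image t) := by
  have memI : ∀ x, x ∈ firstSet (sL t Finset.univ * w) i ↔
      ((w⁻¹ (sL t Finset.univ x) : Fin n) : ℕ) < i := by
    intro x
    rw [mem_firstSet_mul ht, mem_firstSet]
  have memJ : ∀ x, x ∈ firstSet w j ↔ ((w⁻¹ x : Fin n) : ℕ) < j := mem_firstSet w j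
  have ei := eff_pos ht hm hi
  have ej := eff_pos ht hm hj
  have sa : ∀ k, sL t Finset.univ (t k).1 = (t k).2 := fun k => sL_fst ht (Finset.mem_univ k)
  have sb : ∀ k, sL t Finset.univ (t k).2 = (t k).1 := fun k => sL_snd ht (Finset.mem_univ k)
  have mm : ∀ a b, (a, b) ∈ Finset.univ.image t → ∃ k, a = (t k).1 ∧ b = (t k).2 := by
    intro a b h
    obtain ⟨k, _, hk⟩ := Finset.mem_image.mp h
    exact ⟨k, by rw [hk], by rw [hk]⟩
  have mk : ∀ k, ((t k).1, (t k).2) ∈ Finset.univ.image t := fun k =>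
    Finset.mem_image.mpr ⟨k, Finset.mem_univ _, rfl⟩
  have tri : ∀ x, sL t Finset.univ x = x ∨ ∃ k, x = (t k).1 ∨ x = (t k).2 := by
    intro x
    by_cases h : ∃ k, x = (t k).1 ∨ x = (t k).2
    · exact Or.inr h
    · left
      push Not at h
      exact sL_other t _ x (fun k _ => h k)
  constructor
  · intro a b h
    obtain ⟨k, rfl, rfl⟩ := mm a b h
    exact ht.1 k
  · intro a b h
    obtain ⟨k, rfl, rfl⟩ := mm a b h
    rw [memI, memJ, sa]
    have := ei k
    omega
  · intro a b h
    obtain ⟨k, rfl, rfl⟩ := mm a b h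
    rw [memI, memJ, sb]
    have := ej k
    have := ei k
    omega
  · intro b h1 h2
    rw [memI] at h1
    rw [memJ] at h2
    rcases tri b with h | ⟨k, rfl | rfl⟩
    · rw [h] at h1
      omega
    · have := ej k
      omega
    · exact ⟨_, mk k⟩
  · intro a b c h h1 h2 h3 h4
    obtain ⟨k, rfl, rfl⟩ := mm a b h
    rw [memJ] at h3
    rw [memI] at h4
    have hb := mono_between ht hm k c h1 h2
    have e1 := ei k
    have e2 := ej k
    rcases tri c with h5 | ⟨l, rfl | rfl⟩
    · rw [h5] at h4
      omega
    · refine ⟨_, mk l, ?_⟩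
      have hkl : l ≠ k := by
        rintro rfl
        exact lt_irrefl _ h1
      have h6 := mono_nocross ht hm hi k l h1 h2
      exact lt_of_le_of_ne (not_lt.mp h6) (orth_ne ht hkl).2.2.2
    · have := ej l
      omega
  · intro a b a' b' h h' h1 h2
    obtain ⟨k, rfl, rfl⟩ := mm a b h
    obtain ⟨l, rfl, rfl⟩ := mm a' b' h'
    have hkl : k ≠ l := by
      rintro rfl
      exact lt_irrefl _ h2
    by_contra h3
    have h4 : (t l).1 < (t k).1 := lt_of_le_of_ne (not_lt.mp h3) (orth_ne ht hkl).1.symm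
    exact mono_nocross ht hm hi l k h4 h1 h2
  · intro a b b' h h'
    obtain ⟨k, rfl, rfl⟩ := mm a b h
    obtain ⟨l, h1, rfl⟩ := mm _ b' h'
    by_cases hkl : k = l
    · rw [hkl]
    · exact absurd h1 (orth_ne ht hkl).1
  · intro a a' b h h'
    obtain ⟨k, rfl, rfl⟩ := mm a b h
    obtain ⟨l, rfl, h1⟩ := mm a' _ h'
    by_cases hkl : k = l
    · rw [hkl]
    · exact absurd h1 (orth_ne ht hkl).2.2.2


lemma card_firstSet {n : ℕ} (w : Equiv.Perm (Fin n)) {m : ℕ} (hm : m ≤ n) :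
    (firstSet w m).card = m := by
  unfold firstSet
  rw [Finset.card_image_of_injective _ w.injective, Fin.card_filter_val_lt]
  exact min_eq_right hm

lemma firstSet_eq {n : ℕ} (w : Equiv.Perm (Fin n)) (S : Finset (Fin n))
    (h : ∀ x ∈ S, ∀ y ∉ S, w⁻¹ x < w⁻¹ y) : firstSet w S.card = S := by
  have hc : (firstSet w S.card).card = S.card := by
    apply card_firstSet
    simpa using Finset.card_le_univ S
  by_cases hs : S ⊆ firstSet w S.card
  · exact (Finset.eq_of_subset_of_card_le hs hc.le).symm
  · apply Finset.eq_of_subset_of_card_le _ hc.ge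
    rw [Finset.not_subset] at hs
    obtain ⟨x, hx, hx'⟩ := hs
    intro y hy
    by_contra hy'
    have h1 := h x hx y hy'
    rw [mem_firstSet] at hx' hy
    omega

open Classical in
def key {n : ℕ} (I J : Finset (Fin n)) (M : Finset (Fin n × Fin n)) (c : Fin n) : ℕ :=
  if c ∈ J then
    (if c ∈ I then (c : ℕ) else if ∃ e, (c, e) ∈ M then 2 * n - c else 2 * n + 1 + c)
  else if c ∈ I then 4 * n - c else 4 * n + 1 + c

lemma exists_datum {n : ℕ} {I J : Finset (Fin n)} {M : Finset (Fin n × Fin n)}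
    (h : IsM I J M) {i j : ℕ} (hi : I.card = i) (hj : J.card = j) :
    ∃ (d : ℕ) (w : Equiv.Perm (Fin n)) (t : Fin d → Fin n × Fin n),
      IsOrthocell t ∧ Monogressive w t ∧ Effective w t i ∧ Effective w t j ∧
      firstSet (sL t Finset.univ * w) i = I ∧ firstSet w j = J := by
  classical
  set w : Equiv.Perm (Fin n) := Tuple.sort (key I J M) with hw
  have hpos : ∀ c c', key I J M c < key I J M c' → w⁻¹ c < w⁻¹ c' := by
    intro c c' hk
    by_contra hcon
    have h1 := Tuple.monotone_sort (key I J M) (not_lt.mp hcon)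
    simp only [Function.comp, ← hw, ap_inv] at h1
    omega
  let t : Fin M.card → Fin n × Fin n := fun k => (M.equivFin.symm k : Fin n × Fin n)
  have tm : ∀ k, ((t k).1, (t k).2) ∈ M := fun k => (M.equivFin.symm k).2
  have tsurj : ∀ a b, (a, b) ∈ M → ∃ k, (t k).1 = a ∧ (t k).2 = b := by
    intro a b hab
    refine ⟨M.equivFin ⟨(a, b), hab⟩, ?_⟩
    simp [t]
  have tinj : ∀ k l, (t k).1 = (t l).1 → (t k).2 = (t l).2 → k = l := by
    intro k l h1 h2
    have : t k = t l := Prod.ext h1 h2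
    exact M.equivFin.symm.injective (Subtype.ext this)
  have ht : IsOrthocell t := by
    refine ⟨fun k => h.lt _ _ (tm k), ?_⟩
    intro k l hkl
    rw [Set.eq_empty_iff_forall_notMem]
    intro x hx
    simp only [Set.mem_inter_iff, Set.mem_insert_iff, Set.mem_singleton_iff] at hx
    have hk := tm k
    have hl := tm l
    rcases hx with ⟨h1 | h1, h2 | h2⟩
    · have e : (t k).1 = (t l).1 := h1.symm.trans h2
      rw [← e] at hl
      exact hkl (tinj k l e (h.inj1 _ _ _ hk hl))
    · have e : (t k).1 = (t l).2 := h1.symm.trans h2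
      have h3 := (h.fst _ _ hk).1
      rw [e] at h3
      exact (h.snd _ _ hl).2 h3
    · have e : (t k).2 = (t l).1 := h1.symm.trans h2
      have h3 := (h.fst _ _ hl).1
      rw [← e] at h3
      exact (h.snd _ _ hk).2 h3
    · have e : (t k).2 = (t l).2 := h1.symm.trans h2
      rw [← e] at hl
      exact hkl (tinj k l (h.inj2 _ _ _ hk hl) e)
  have kX : ∀ c, c ∈ I → c ∈ J → key I J M c = c := by
    intro c h1 h2
    simp [key, h1, h2]
  have kA : ∀ a b, (a, b) ∈ M → key I J M a = 2 * n - a := by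
    intro a b hab
    have h1 := h.fst _ _ hab
    have h2 : ∃ e, (a, e) ∈ M := ⟨b, hab⟩
    simp only [key, h1.1, h1.2, h2, if_true, if_false]
  have kB : ∀ a b, (a, b) ∈ M → key I J M b = 4 * n - b := by
    intro a b hab
    have h1 := h.snd _ _ hab
    simp only [key, h1.1, h1.2, if_true, if_false]
  have kU : ∀ c, c ∈ J → c ∉ I → (¬ ∃ e, (c, e) ∈ M) → key I J M c = 2 * n + 1 + c := by
    intro c h1 h2 h3
    simp only [key, h1, h2, h3, if_true, if_false]
  have kZ : ∀ c, c ∉ J → c ∉ I → key I J M c = 4 * n + 1 + c := by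
    intro c h1 h2
    simp only [key, h1, h2, if_false]
  have kJ : ∀ c, c ∈ J → key I J M c ≤ 3 * n := by
    intro c h1
    simp only [key, h1, if_true]
    split_ifs <;> omega
  have kJ' : ∀ c, c ∉ J → 3 * n < key I J M c := by
    intro c h1
    simp only [key, h1, if_false]
    split_ifs <;> omega
  have FJ : firstSet w j = J := by
    rw [← hj]
    apply firstSet_eq
    intro x hx y hy
    apply hpos
    have := kJ x hx
    have := kJ' y hy
    omega
  have FI : firstSet w i = (I ∩ J) ∪ M.image Prod.fst := by
    have hc : ((I ∩ J) ∪ M.image Prod.fst).card = i := by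
      rw [Finset.card_union_of_disjoint, Finset.card_image_of_injOn]
      · have h1 : (I \ J) = M.image Prod.snd := by
          ext x
          simp only [Finset.mem_sdiff, Finset.mem_image, Prod.exists, exists_eq_right]
          constructor
          · intro hx
            exact h.ex x hx.1 hx.2
          · rintro ⟨a, ha⟩
            exact h.snd _ _ ha
        have h2 : (M.image Prod.snd).card = M.card := by
          apply Finset.card_image_of_injOn
          rintro ⟨a, b⟩ h1 ⟨a', b'⟩ h2 (h3 : b = b')
          subst h3
          rw [h.inj2 a a' b h1 h2]
        rw [← h2, ← h1, ← hi]
        exact Finset.card_inter_add_card_sdiff I J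
      · rintro ⟨a, b⟩ h1 ⟨a', b'⟩ h2 (h3 : a = a')
        subst h3
        rw [h.inj1 a b b' h1 h2]
      · rw [Finset.disjoint_left]
        intro x hx hx'
        simp only [Finset.mem_image, Prod.exists, exists_and_right, exists_eq_right] at hx'
        obtain ⟨b, hb⟩ := hx'
        exact (h.fst _ _ hb).2 (Finset.mem_inter.mp hx).1
    rw [← hc]
    apply firstSet_eq
    intro x hx y hy
    apply hpos
    simp only [Finset.mem_union, Finset.mem_inter, Finset.mem_image, Prod.exists,
      exists_and_right, exists_eq_right, not_or, not_and] at hx hy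
    have h1 : key I J M x ≤ 2 * n := by
      rcases hx with hx | ⟨b, hb⟩
      · rw [kX x hx.1 hx.2]
        omega
      · rw [kA x b hb]
        omega
    have h2 : 2 * n < key I J M y := by
      by_cases hyJ : y ∈ J
      · have hyI : y ∉ I := fun hh => hy.1 hh hyJ
        rw [kU y hyJ hyI hy.2]
        omega
      · have := kJ' y hyJ
        omega
    omega
  have memI : ∀ x, x ∈ firstSet w i ↔ (x ∈ I ∧ x ∈ J) ∨ ∃ b, (x, b) ∈ M := by
    intro x
    rw [FI]
    simp
  refine ⟨M.card, w, t, ht, ?_, ?_, ?_, ?_, FJ⟩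
  · intro L
    induction L using Finset.induction_on with
    | empty => simp [sL_empty]
    | insert k L hk ih =>
      rw [sL_insert ht hk, Finset.card_insert_of_notMem hk, mul_assoc, ← add_assoc, ← ih]
      rw [step_iff _ _ _ (ht.1 k)]
      rw [mul_inv_rev, sL_inv ht, Equiv.Perm.mul_apply, Equiv.Perm.mul_apply, sL_fst' ht hk,
        sL_snd' ht hk]
      have hmk := tm k
      have ka := kA _ _ hmk
      have kb := kB _ _ hmk
      refine ⟨hpos _ _ (by rw [ka, kb]; omega), ?_⟩
      intro r hr1 hr2
      rw [Equiv.Perm.mul_apply]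
      obtain ⟨c, rfl⟩ : ∃ c, r = w⁻¹ c := ⟨w r, by simp⟩
      rw [ap_inv]
      have n1 : ¬ key I J M c < key I J M (t k).1 := fun hh =>
        absurd (hpos _ _ hh) (not_lt.mpr hr1.le)
      have n2 : ¬ key I J M (t k).2 < key I J M c := fun hh =>
        absurd (hpos _ _ hh) (not_lt.mpr hr2.le)
      rw [ka] at n1
      rw [kb] at n2
      rintro ⟨h1, h2⟩
      by_cases hc : ∀ l ∈ L, c ≠ (t l).1 ∧ c ≠ (t l).2
      · rw [sL_other t L c hc] at h1 h2
        by_cases cJ : c ∈ J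
        · by_cases cI : c ∈ I
          · have := kX c cI cJ
            omega
          · obtain ⟨e, he, _⟩ := h.inl _ _ c hmk h1 h2 cJ cI
            have := kA _ _ he
            omega
        · by_cases cI : c ∈ I
          · obtain ⟨e, he⟩ := h.ex c cI cJ
            have := kB _ _ he
            omega
          · have := kZ c cJ cI
            omega
      · push Not at hc
        obtain ⟨l, hl, hc⟩ := hc
        have hml := tm l
        have la := kA _ _ hml
        have lb := kB _ _ hml
        by_cases hc1 : c = (t l).1
        · rw [hc1] at h1 h2 n1
          rw [sL_fst ht hl] at h1 h2
          have h3 := h.inr _ _ _ _ hmk hml h1 h2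
          omega
        · rw [hc hc1] at h1 h2 n2
          rw [sL_snd ht hl] at h1 h2
          have hf := h.fst _ _ hml
          obtain ⟨e, he, h3⟩ := h.inl _ _ _ hmk h1 h2 hf.1 hf.2
          rw [h.inj1 _ _ _ he hml] at h3
          omega
  · intro k
    left
    rw [memI, memI]
    refine ⟨Or.inr ⟨_, tm k⟩, ?_⟩
    have h1 := h.snd _ _ (tm k)
    rintro (h2 | ⟨e, he⟩)
    · exact h1.2 h2.2
    · exact (h.fst _ _ he).2 h1.1
  · intro k
    left
    rw [FJ]
    exact ⟨(h.fst _ _ (tm k)).1, (h.snd _ _ (tm k)).2⟩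
  · ext x
    rw [mem_firstSet_mul ht, memI]
    by_cases hx : ∃ k, x = (t k).1 ∨ x = (t k).2
    · obtain ⟨k, rfl | rfl⟩ := hx
      · rw [sL_fst ht (Finset.mem_univ k)]
        have h1 := h.fst _ _ (tm k)
        have h2 := h.snd _ _ (tm k)
        constructor
        · rintro (h3 | ⟨e, he⟩)
          · exact absurd h3.2 h2.2
          · exact absurd (h.fst _ _ he).1 h2.2
        · intro h3
          exact absurd h3 h1.2
      · rw [sL_snd ht (Finset.mem_univ k)]
        have h2 := h.snd _ _ (tm k)
        exact ⟨fun _ => h2.1, fun _ => Or.inr ⟨_, tm k⟩⟩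
    · push Not at hx
      rw [sL_other t _ x (fun k _ => hx k)]
      constructor
      · rintro (h3 | ⟨e, he⟩)
        · exact h3.1
        · obtain ⟨k, hk, _⟩ := tsurj _ _ he
          exact absurd hk.symm (hx k).1
      · intro h3
        left
        refine ⟨h3, ?_⟩
        by_contra h4
        obtain ⟨a, ha⟩ := h.ex x h3 h4
        obtain ⟨k, _, hk⟩ := tsurj _ _ ha
        exact absurd hk.symm (hx k).2


lemma eW_eq {n i : ℕ} (hin : i ≤ n) (u : Equiv.Perm (Fin n)) :
    eW n i u = exteriorPower.ιMulti ℂ i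
      (fun k : Fin i => (Pi.single (u (Fin.castLE hin k)) (1 : ℂ) : Fin n → ℂ)) := by
  apply Subtype.ext
  rw [exteriorPower.ιMulti_apply_coe]
  unfold eW
  simp only
  congr 1
  funext k
  rw [dif_pos (lt_of_lt_of_le k.2 hin)]
  rfl

lemma exists_perm {n i : ℕ} (hin : i ≤ n) {w w' : Equiv.Perm (Fin n)}
    (h : firstSet w' i = firstSet w i) :
    ∃ σ : Equiv.Perm (Fin i), ∀ k, w' (Fin.castLE hin k) = w (Fin.castLE hin (σ k)) := by
  have h1 : ∀ k : Fin i, ((w⁻¹ (w' (Fin.castLE hin k)) : Fin n) : ℕ) < i := by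
    intro k
    rw [← mem_firstSet, ← h, mem_firstSet, inv_ap]
    exact k.2
  let f : Fin i → Fin i := fun k => ⟨w⁻¹ (w' (Fin.castLE hin k)), h1 k⟩
  have hf : Function.Injective f := by
    intro a b hab
    have h2 : ((w⁻¹ (w' (Fin.castLE hin a)) : Fin n) : ℕ) =
      ((w⁻¹ (w' (Fin.castLE hin b)) : Fin n) : ℕ) := congrArg (fun z : Fin i => (z : ℕ)) hab
    have h3 := w'.injective (w⁻¹.injective (Fin.ext h2))
    exact Fin.castLE_injective hin h3
  refine ⟨Equiv.ofBijective f (Finite.injective_iff_bijective.mp hf), ?_⟩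
  intro k
  have h4 : Fin.castLE hin (f k) = w⁻¹ (w' (Fin.castLE hin k)) := Fin.ext rfl
  rw [Equiv.ofBijective_apply, h4, ap_inv]

lemma eW_perm {n i : ℕ} (hin : i ≤ n) {w w' : Equiv.Perm (Fin n)}
    (h : firstSet w' i = firstSet w i) :
    ∃ ε : ℂ, ε ≠ 0 ∧ ∀ s : Equiv.Perm (Fin n), eW n i (s * w') = ε • eW n i (s * w) := by
  obtain ⟨σ, hσ⟩ := exists_perm hin h
  refine ⟨((Equiv.Perm.sign σ : ℤ) : ℂ), ?_, ?_⟩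
  · rcases Int.units_eq_one_or (Equiv.Perm.sign σ) with h1 | h1 <;> simp [h1]
  · intro s
    rw [eW_eq hin, eW_eq hin]
    have h1 : (fun k : Fin i => (Pi.single ((s * w') (Fin.castLE hin k)) (1 : ℂ) : Fin n → ℂ)) =
      (fun k : Fin i => (Pi.single ((s * w) (Fin.castLE hin k)) (1 : ℂ) : Fin n → ℂ)) ∘ σ := by
      funext k
      simp only [Function.comp, Equiv.Perm.mul_apply, hσ]
    rw [h1, AlternatingMap.map_perm]
    rcases Int.units_eq_one_or (Equiv.Perm.sign σ) with h2 | h2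
    · simp [h2]
    · simp only [h2, Units.neg_smul, one_smul, Units.val_neg, Units.val_one, Int.cast_neg,
        Int.cast_one]
      exact (neg_one_smul ℂ _).symm

def coordW {n i : ℕ} (hin : i ≤ n) (v : Equiv.Perm (Fin n)) : (⋀[ℂ]^i (Fin n → ℂ)) →ₗ[ℂ] ℂ :=
  exteriorPower.alternatingMapLinearEquiv
    ((Matrix.detRowAlternating (R := ℂ) (n := Fin i)).compLinearMap
      (LinearMap.funLeft ℂ ℂ (fun s : Fin i => v (Fin.castLE hin s))))

lemma coordW_apply {n i : ℕ} (hin : i ≤ n) (v u : Equiv.Perm (Fin n)) :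
    coordW hin v (eW n i u) = Matrix.det (Matrix.of fun r s : Fin i =>
      (Pi.single (u (Fin.castLE hin r)) (1 : ℂ) : Fin n → ℂ) (v (Fin.castLE hin s))) := by
  rw [eW_eq hin, coordW, exteriorPower.alternatingMapLinearEquiv_apply_ιMulti]
  rfl

lemma coordW_self {n i : ℕ} (hin : i ≤ n) (v : Equiv.Perm (Fin n)) :
    coordW hin v (eW n i v) = 1 := by
  rw [coordW_apply]
  rw [← Matrix.det_one (n := Fin i) (R := ℂ)]
  congr 1
  ext r s
  simp only [Matrix.of_apply, Matrix.one_apply, Pi.single_apply]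
  by_cases h : r = s
  · simp [h]
  · rw [if_neg h, if_neg]
    intro h1
    exact h (Fin.castLE_injective hin (v.injective h1)).symm

lemma coordW_ne {n i : ℕ} (hin : i ≤ n) {v u : Equiv.Perm (Fin n)}
    (h : firstSet u i = firstSet v i) : coordW hin v (eW n i u) ≠ 0 := by
  obtain ⟨ε, hε, h1⟩ := eW_perm hin h
  have h2 := h1 1
  rw [one_mul, one_mul] at h2
  rw [h2, map_smul, coordW_self]
  simpa using hε

lemma coordW_eq {n i : ℕ} (hin : i ≤ n) {v u : Equiv.Perm (Fin n)}
    (h : coordW hin v (eW n i u) ≠ 0) : firstSet u i = firstSet v i := by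
  apply Finset.eq_of_subset_of_card_le
  · intro x hx
    by_contra hx'
    apply h
    rw [coordW_apply]
    rw [mem_firstSet] at hx
    apply Matrix.det_eq_zero_of_row_eq_zero ⟨_, hx⟩
    intro s
    have h2 : Fin.castLE hin ⟨_, hx⟩ = u⁻¹ x := Fin.ext rfl
    rw [Matrix.of_apply, h2, ap_inv, Pi.single_apply, if_neg]
    rintro rfl
    apply hx'
    rw [mem_firstSet, inv_ap]
    exact s.2
  · rw [card_firstSet _ hin, card_firstSet _ hin]

def coordT {n i j : ℕ} (hin : i ≤ n) (hjn : j ≤ n) (v v' : Equiv.Perm (Fin n)) :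
    ((⋀[ℂ]^i (Fin n → ℂ)) ⊗[ℂ] (⋀[ℂ]^j (Fin n → ℂ))) →ₗ[ℂ] ℂ :=
  LinearMap.mul' ℂ ℂ ∘ₗ TensorProduct.map (coordW hin v) (coordW hjn v')

lemma coordT_eT {n i j d : ℕ} (hin : i ≤ n) (hjn : j ≤ n) (v v' : Equiv.Perm (Fin n)) (q : ℂ)
    (w : Equiv.Perm (Fin n)) (t : Fin d → Fin n × Fin n) :
    coordT hin hjn v v' (eT q i j w t) = ∑ L : Finset (Fin d),
      q ^ L.card * (coordW hin v (eW n i (sL t Lᶜ * w)) * coordW hjn v' (eW n j (sL t L * w))) := by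
  unfold eT
  rw [map_sum]
  apply Finset.sum_congr rfl
  intro L _
  rw [map_smul, smul_eq_mul]
  rfl

def wt {n : ℕ} (S : Finset (Fin n)) : ℕ := ∑ x ∈ S, (x : ℕ)

lemma wt_lt {n d : ℕ} {t : Fin d → Fin n × Fin n} (ht : IsOrthocell t)
    {w : Equiv.Perm (Fin n)} (hm : Monogressive w t) {j : ℕ} (hj : Effective w t j)
    {L : Finset (Fin d)} (hL : L ≠ ∅) :
    wt (firstSet w j) < wt (firstSet (sL t L * w) j) := by
  have h1 : firstSet (sL t L * w) j = (firstSet w j).image (sL t L) := by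
    ext x
    rw [mem_firstSet_mul ht, Finset.mem_image]
    constructor
    · intro h
      exact ⟨_, h, sL_invol ht L x⟩
    · rintro ⟨y, hy, rfl⟩
      rwa [sL_invol ht]
  rw [h1, wt, wt, Finset.sum_image (fun x _ y _ h => (sL t L).injective h)]
  have ej := eff_pos ht hm hj
  apply Finset.sum_lt_sum
  · intro x hx
    rw [mem_firstSet] at hx
    by_cases hc : ∀ l ∈ L, x ≠ (t l).1 ∧ x ≠ (t l).2
    · rw [sL_other t L x hc]
    · push Not at hc
      obtain ⟨l, hl, hc⟩ := hc
      by_cases hc1 : x = (t l).1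
      · rw [hc1, sL_fst ht hl]
        exact (ht.1 l).le
      · rw [hc hc1] at hx
        have := ej l
        omega
  · obtain ⟨k, hk⟩ := Finset.nonempty_iff_ne_empty.mpr hL
    refine ⟨(t k).1, ?_, ?_⟩
    · rw [mem_firstSet]
      exact (ej k).1
    · rw [sL_fst ht hk]
      exact ht.1 k

lemma coordT_diag {n i j d : ℕ} (hin : i ≤ n) (hjn : j ≤ n) (q : ℂ)
    {t : Fin d → Fin n × Fin n} (ht : IsOrthocell t)
    {w : Equiv.Perm (Fin n)} (hm : Monogressive w t) (hj : Effective w t j) :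
    coordT hin hjn (sL t Finset.univ * w) w (eT q i j w t) ≠ 0 := by
  rw [coordT_eT, Finset.sum_eq_single ∅]
  · have e : (1 : Equiv.Perm (Fin n)) * w = w := one_mul w
    rw [Finset.compl_empty, coordW_self, sL_empty, e, coordW_self]
    simp
  · intro L _ hL
    have h1 : coordW hjn w (eW n j (sL t L * w)) = 0 := by
      by_contra hcon
      have h2 := coordW_eq hjn hcon
      have h3 := wt_lt ht hm hj hL
      rw [h2] at h3
      exact lt_irrefl _ h3
    rw [h1]
    simp
  · intro h
    exact absurd (Finset.mem_univ _) h

lemma coordT_off {n i j d : ℕ} (hin : i ≤ n) (hjn : j ≤ n) (q : ℂ)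
    {t : Fin d → Fin n × Fin n} (ht : IsOrthocell t)
    {w : Equiv.Perm (Fin n)} (hm : Monogressive w t) (hj : Effective w t j)
    (v v' : Equiv.Perm (Fin n)) (h : coordT hin hjn v v' (eT q i j w t) ≠ 0) :
    (firstSet (sL t Finset.univ * w) i = firstSet v i ∧ firstSet w j = firstSet v' j) ∨
      wt (firstSet w j) < wt (firstSet v' j) := by
  rw [coordT_eT] at h
  obtain ⟨L, _, hL⟩ := Finset.exists_ne_zero_of_sum_ne_zero h
  have h1 := coordW_eq hin (left_ne_zero_of_mul (right_ne_zero_of_mul hL))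
  have h2 := coordW_eq hjn (right_ne_zero_of_mul (right_ne_zero_of_mul hL))
  by_cases hLe : L = ∅
  · left
    rw [hLe, Finset.compl_empty] at h1
    rw [hLe, sL_empty, one_mul] at h2
    exact ⟨h1, h2⟩
  · right
    rw [← h2]
    exact wt_lt ht hm hj hLe

lemma eT_unique {n i j d d' : ℕ} (hin : i ≤ n) (hjn : j ≤ n) (hij : i < j) (q : ℂ)
    {t : Fin d → Fin n × Fin n} (ht : IsOrthocell t)
    {w : Equiv.Perm (Fin n)} (hm : Monogressive w t) (hi : Effective w t i)
    (hj : Effective w t j)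
    {t' : Fin d' → Fin n × Fin n} (ht' : IsOrthocell t')
    {w' : Equiv.Perm (Fin n)} (hm' : Monogressive w' t') (hi' : Effective w' t' i)
    (hj' : Effective w' t' j)
    (hI : firstSet (sL t' Finset.univ * w') i = firstSet (sL t Finset.univ * w) i)
    (hJ : firstSet w' j = firstSet w j) :
    ∃ ε : ℂ, eT q i j w' t' = ε • eT q i j w t := by
  have hM := datum_isM ht hm hij hi hj
  have hM' := datum_isM ht' hm' hij hi' hj'
  rw [hI, hJ] at hM'
  have hMM := hM'.unique hM
  have inj : ∀ {m : ℕ} {s : Fin m → Fin n × Fin n}, IsOrthocell s → Function.Injective s := by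
    intro m s hs k l hkl
    by_contra hne
    exact (orth_ne hs hne).1 (by rw [hkl])
  have h1 : ∀ k', ∃ k, t k = t' k' := by
    intro k'
    have : t' k' ∈ Finset.univ.image t := by
      rw [← hMM]
      exact Finset.mem_image_of_mem _ (Finset.mem_univ _)
    obtain ⟨k, _, hk⟩ := Finset.mem_image.mp this
    exact ⟨k, hk⟩
  have h2 : ∀ k, ∃ k', t' k' = t k := by
    intro k
    have : t k ∈ Finset.univ.image t' := by
      rw [hMM]
      exact Finset.mem_image_of_mem _ (Finset.mem_univ _)
    obtain ⟨k, _, hk⟩ := Finset.mem_image.mp this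
    exact ⟨k, hk⟩
  choose f hf using h1
  have hbij : Function.Bijective f := by
    constructor
    · intro a b hab
      apply inj ht'
      rw [← hf, ← hf, hab]
    · intro k
      obtain ⟨k', hk'⟩ := h2 k
      refine ⟨k', inj ht ?_⟩
      rw [hf, hk']
  let σ : Fin d' ≃ Fin d := Equiv.ofBijective f hbij
  have hσ : ∀ k, t' k = t (σ k) := fun k => (hf k).symm
  have hs := sL_comp ht ht' σ hσ
  have hsu : sL t' Finset.univ = sL t Finset.univ := by
    rw [hs, Finset.map_univ_equiv]
  have hIw : firstSet w' i = firstSet w i := by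
    ext x
    have e1 := mem_firstSet_mul ht Finset.univ w i (sL t Finset.univ x)
    have e2 := mem_firstSet_mul ht' Finset.univ w' i (sL t' Finset.univ x)
    rw [sL_invol ht] at e1
    rw [sL_invol ht', hI, hsu] at e2
    rw [← e1, ← e2]
  obtain ⟨ε₁, _, he₁⟩ := eW_perm hin hIw
  obtain ⟨ε₂, _, he₂⟩ := eW_perm hjn hJ
  refine ⟨ε₁ * ε₂, ?_⟩
  unfold eT
  rw [Finset.smul_sum]
  apply Fintype.sum_equiv (Equiv.finsetCongr σ)
  intro L
  rw [Equiv.finsetCongr_apply, Finset.card_map, hs, hs L, he₁, he₂]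
  have hc : (Lᶜ).map σ.toEmbedding = (L.map σ.toEmbedding)ᶜ := by
    ext k
    simp [Finset.mem_map_equiv]
  rw [hc, TensorProduct.smul_tmul_smul, smul_comm]

lemma li_of_triangular {V ι : Type*} [AddCommGroup V] [Module ℂ V] (v : ι → V) (f : ι → ℕ)
    (φ : ι → V →ₗ[ℂ] ℂ) (hd : ∀ g, φ g (v g) ≠ 0)
    (ho : ∀ g h, φ g (v h) ≠ 0 → h = g ∨ f h < f g) : LinearIndependent ℂ v := by
  classical
  rw [linearIndependent_iff']
  intro s c hc g₀ hg₀
  by_contra hne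
  obtain ⟨g, hg, hmin⟩ := Finset.exists_min_image (s.filter (fun g => c g ≠ 0))
    f ⟨g₀, Finset.mem_filter.mpr ⟨hg₀, hne⟩⟩
  rw [Finset.mem_filter] at hg
  have h1 := congrArg (φ g) hc
  rw [map_sum, map_zero, Finset.sum_eq_single g] at h1
  · rw [map_smul, smul_eq_mul] at h1
    exact mul_ne_zero hg.2 (hd g) h1
  · intro h hh hhg
    rw [map_smul, smul_eq_mul]
    by_contra hcon
    have h2 := left_ne_zero_of_mul hcon
    have h3 := ho g h (right_ne_zero_of_mul hcon)
    have h4 := hmin h (Finset.mem_filter.mpr ⟨hh, h2⟩)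
    rcases h3 with h3 | h3
    · exact hhg h3
    · omega
  · intro h
    exact absurd hg.1 h

lemma finrank_of_triangular {V ι : Type*} [AddCommMonoid V] [Module ℂ V] [Fintype ι]
    (v : ι → V) (f : ι → ℕ)
    (φ : ι → V →ₗ[ℂ] ℂ) (hd : ∀ g, φ g (v g) ≠ 0)
    (ho : ∀ g h, φ g (v h) ≠ 0 → h = g ∨ f h < f g) :
    Module.finrank ℂ (Submodule.span ℂ (Set.range v)) = Fintype.card ι := by
  letI : AddCommGroup V := Module.addCommMonoidToAddCommGroup ℂ
  exact finrank_span_eq_card (li_of_triangular v f φ hd ho)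

/-- For `q` not a root of unity and `1 ≤ i < j ≤ n − 1`, the span of the
vectors `e_C^{ij}`, `C` ranging over all monogressive `ij`-effective orthocell data in
`Sₙ`, has dimension `D(n; i, j) = C(n,i)·C(n,j) − C(n,i−1)·C(n,j+1)`. -/
theorem finrank_span_eT (n i j : ℕ) (hi : 1 ≤ i) (hij : i < j) (hj : j ≤ n - 1)
    (q : ℂ) (hq : q ≠ 0) (hroot : ∀ k : ℕ, 0 < k → q ^ k ≠ 1) :
    (Module.finrank ℂ (Submodule.span ℂ
        {v : (⋀[ℂ]^i (Fin n → ℂ)) ⊗[ℂ] (⋀[ℂ]^j (Fin n → ℂ)) |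
          ∃ (d : ℕ) (w : Equiv.Perm (Fin n)) (t : Fin d → Fin n × Fin n),
            IsOrthocell t ∧ Monogressive w t ∧ Effective w t i ∧ Effective w t j ∧
            v = eT q i j w t}) : ℤ) =
      (n.choose i : ℤ) * n.choose j - (n.choose (i - 1) : ℤ) * n.choose (j + 1) := by
  have hin : i ≤ n := by omega
  have hjn : j ≤ n := by omega
  rw [← card_goodSet n i j hi hij]
  have hex : ∀ g : {x // x ∈ goodSet n i j}, ∃ (d : ℕ) (w : Equiv.Perm (Fin n))
      (t : Fin d → Fin n × Fin n),
      IsOrthocell t ∧ Monogressive w t ∧ Effective w t i ∧ Effective w t j ∧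
      firstSet (sL t Finset.univ * w) i = g.1.1 ∧ firstSet w j = g.1.2 := by
    intro g
    have hg := mem_goodSet.mp g.2
    obtain ⟨M, hM⟩ := exists_isM _ g.1.1 g.1.2 rfl hg.2
    exact exists_datum hM hg.1.1 hg.1.2
  choose D W T hT hMo hEi hEj hLI hLJ using hex
  have hfin : Module.finrank ℂ (Submodule.span ℂ (Set.range
      (fun g : {x // x ∈ goodSet n i j} => eT q i j (W g) (T g)))) =
      Fintype.card {x // x ∈ goodSet n i j} := by
    refine finrank_of_triangular _ (fun g => wt g.1.2)
      (fun g => coordT hin hjn (sL (T g) Finset.univ * W g) (W g))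
      (fun g => coordT_diag hin hjn q (hT g) (hMo g) (hEj g)) ?_
    intro g h hne
    have h3 := coordT_off hin hjn q (hT h) (hMo h) (hEj h) _ _ hne
    rw [hLI, hLI, hLJ, hLJ] at h3
    rcases h3 with h3 | h3
    · exact Or.inl (Subtype.ext (Prod.ext h3.1 h3.2))
    · exact Or.inr h3
  have hspan : Submodule.span ℂ
        {v : (⋀[ℂ]^i (Fin n → ℂ)) ⊗[ℂ] (⋀[ℂ]^j (Fin n → ℂ)) |
          ∃ (d : ℕ) (w : Equiv.Perm (Fin n)) (t : Fin d → Fin n × Fin n),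
            IsOrthocell t ∧ Monogressive w t ∧ Effective w t i ∧ Effective w t j ∧
            v = eT q i j w t} =
      Submodule.span ℂ (Set.range
        (fun g : {x // x ∈ goodSet n i j} => eT q i j (W g) (T g))) := by
    apply le_antisymm
    · rw [Submodule.span_le]
      rintro v ⟨d, w, t, ht, hm, hei, hej, rfl⟩
      have hgood := (datum_isM ht hm hij hei hej).good
      let g : {x // x ∈ goodSet n i j} :=
        ⟨(firstSet (sL t Finset.univ * w) i, firstSet w j),
          mem_goodSet.mpr ⟨⟨card_firstSet _ hin, card_firstSet _ hjn⟩, hgood⟩⟩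
      obtain ⟨ε, he⟩ := eT_unique hin hjn hij q (hT g) (hMo g) (hEi g) (hEj g) ht hm hei hej
        (hLI g).symm (hLJ g).symm
      rw [he]
      exact Submodule.smul_mem _ _ (Submodule.subset_span ⟨g, rfl⟩)
    · apply Submodule.span_mono
      rintro _ ⟨g, rfl⟩
      exact ⟨D g, W g, T g, hT g, hMo g, hEi g, hEj g, rfl⟩
  rw [Fintype.card_coe] at hfin
  rw [hspan]
  exact_mod_cast hfin

end QFlag
end
end

section
/- Let 1 ≤ i, j ≤ n−1, q ∈ ℂ*, and let C = (w; t_1,…,t_d) be a monogressive ij-effective orthocell datum in S_n. Then for every pair of disjoint subsets I, J ⊆ {1,…,d}, the datum (s_J w; (t_k)_{k∈I}) is again monogressive and ij-effective, and for all scalars x_1,…,x_d, y_1,…,y_d ∈ ℂ (writing x_K := ∏_{k∈K} x_k and y_K := ∏_{k∈K} y_k for K ⊆ {1,…,d}) the following identity holds in Λ^iℂⁿ ⊗ Λ^jℂⁿ: Σ_{L,M ⊆ {1,…,d}} q^{|M|} x_{L̄} x_{M̄} y_L y_M (e^i_{s_L w} ⊗ e^j_{s_M w}) = Σ_{I,J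 ⊆ {1,…,d}, I∩J=∅} q^{|J|} (x_{\overline{I∪J}})² x_I y_I (y_J)² e^{ij}_{(s_J w; (t_k)_{k∈I})}. -/
open Equiv Finset
open scoped TensorProduct

noncomputable section

namespace QFlag
theorem sL_eq_noncommProd_aux {n d : ℕ} {t : Fin d → Fin n × Fin n} (ht : IsOrthocell t)
    (k k' : Fin d) (h : k ≠ k') :
    Commute (Equiv.swap (t k).1 (t k).2) (Equiv.swap (t k').1 (t k').2) := by
  have h1 := ht.2 k k' h
  have hk := ht.1 k
  have hk' := ht.1 k'
  have h2 : ∀ z, z ∈ ({(t k).1, (t k).2} : Set (Fin n)) →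
      z ∉ ({(t k').1, (t k').2} : Set (Fin n)) := fun z hz hz' => by
    have : z ∈ (∅ : Set (Fin n)) := h1 ▸ ⟨hz, hz'⟩
    exact this
  have h3 := h2 (t k).1 (by simp)
  have h4 := h2 (t k).2 (by simp)
  simp only [Set.mem_insert_iff, Set.mem_singleton_iff, not_or] at h3 h4
  apply Equiv.Perm.Disjoint.commute
  intro z
  by_cases hz : z = (t k).1 ∨ z = (t k).2
  · right
    rcases hz with rfl | rfl
    · exact Equiv.swap_apply_of_ne_of_ne h3.1 h3.2
    · exact Equiv.swap_apply_of_ne_of_ne h4.1 h4.2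
  · left
    rw [not_or] at hz
    exact Equiv.swap_apply_of_ne_of_ne hz.1 hz.2

theorem sL_eq_noncommProd {n d : ℕ} {t : Fin d → Fin n × Fin n} (ht : IsOrthocell t)
    (L : Finset (Fin d)) :
    sL t L = L.noncommProd (fun k => Equiv.swap (t k).1 (t k).2)
      (fun k _ k' _ h => sL_eq_noncommProd_aux ht k k' h) := by
  unfold sL
  have h : L = (L.sort (· ≤ ·)).toFinset := by simp
  conv_rhs => simp only [Finset.noncommProd]
  rw [← Multiset.noncommProd_coe]
  · congr 1
    rw [← Multiset.map_coe, Finset.sort_eq]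
  · intro a ha b hb hab
    simp only [Set.mem_setOf_eq, Multiset.mem_coe, List.mem_map] at ha hb
    obtain ⟨k, _, rfl⟩ := ha
    obtain ⟨k', _, rfl⟩ := hb
    refine sL_eq_noncommProd_aux ht k k' ?_
    rintro rfl
    exact hab rfl

theorem sL_union {n d : ℕ} {t : Fin d → Fin n × Fin n} (ht : IsOrthocell t)
    {A B : Finset (Fin d)} (h : Disjoint A B) : sL t (A ∪ B) = sL t A * sL t B := by
  simp only [sL_eq_noncommProd ht]
  exact Finset.noncommProd_union_of_disjoint h _ _

theorem sL_map {n d m : ℕ} {t : Fin d → Fin n × Fin n} (ht : IsOrthocell t)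
    (f : Fin m ↪ Fin d) (ht' : IsOrthocell (fun k => t (f k))) (K : Finset (Fin m)) :
    sL (fun k => t (f k)) K = sL t (K.map f) := by
  induction K using Finset.induction_on with
  | empty => simp [sL]
  | insert a K ha ih =>
    rw [Finset.insert_eq, sL_union ht' (by simpa using ha), ih, Finset.map_union,
      sL_union ht ((Finset.disjoint_map f).2 (by simpa using ha))]
    simp [sL]

theorem isOrthocell_comp {n d m : ℕ} {t : Fin d → Fin n × Fin n} (ht : IsOrthocell t)
    (f : Fin m ↪ Fin d) : IsOrthocell (fun k => t (f k)) :=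
  ⟨fun k => ht.1 _, fun k k' h => ht.2 _ _ (fun h' => h (f.injective h'))⟩

theorem sL_fix {n d : ℕ} {t : Fin d → Fin n × Fin n} (J : Finset (Fin d)) (z : Fin n)
    (hz : ∀ k ∈ J, z ≠ (t k).1 ∧ z ≠ (t k).2) : sL t J z = z := by
  unfold sL
  have : ∀ l : List (Fin d), (∀ k ∈ l, z ≠ (t k).1 ∧ z ≠ (t k).2) →
      (l.map fun k => Equiv.swap (t k).1 (t k).2).prod z = z := by
    intro l
    induction l with
    | nil => simp
    | cons a l ih =>
      intro h
      simp only [List.map_cons, List.prod_cons, Equiv.Perm.mul_apply]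
      rw [ih fun k hk => h k (List.mem_cons_of_mem _ hk)]
      have := h a List.mem_cons_self
      exact Equiv.swap_apply_of_ne_of_ne this.1 this.2
  exact this _ fun k hk => hz k (by simpa using hk)

theorem mem_firstSet_mul_s15 {n : ℕ} (s w : Equiv.Perm (Fin n)) (i : ℕ) (z : Fin n)
    (h : s z = z) : z ∈ firstSet (s * w) i ↔ z ∈ firstSet w i := by
  simp only [firstSet, Finset.mem_image, Equiv.Perm.mul_apply]
  refine exists_congr fun a => and_congr_right fun _ => ?_
  constructor
  · intro h'
    exact s.injective (h'.trans h.symm)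
  · rintro rfl
    exact h

theorem effective_sub {n d m : ℕ} {t : Fin d → Fin n × Fin n} (ht : IsOrthocell t)
    (f : Fin m ↪ Fin d) (J : Finset (Fin d)) (hJ : ∀ k, f k ∉ J) (w : Equiv.Perm (Fin n))
    (i : ℕ) (h : Effective w t i) : Effective (sL t J * w) (fun k => t (f k)) i := by
  intro k
  have key : ∀ z ∈ ({(t (f k)).1, (t (f k)).2} : Set (Fin n)), sL t J z = z := by
    intro z hz
    refine sL_fix J z fun k' hk' => ?_
    have hne : f k ≠ k' := fun e => hJ k (e ▸ hk')
    have h1 := ht.2 _ _ hne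
    have h2 : z ∉ ({(t k').1, (t k').2} : Set (Fin n)) := fun hz' => by
      have : z ∈ (∅ : Set (Fin n)) := h1 ▸ ⟨hz, hz'⟩
      exact this
    simpa [not_or] using h2
  simp only [mem_firstSet_mul_s15 _ w i _ (key _ (Set.mem_insert _ _)),
    mem_firstSet_mul_s15 _ w i _ (key _ (Set.mem_insert_of_mem _ rfl))]
  exact h (f k)

theorem eT_sub {n d : ℕ} {t : Fin d → Fin n × Fin n} (ht : IsOrthocell t) (q : ℂ) (i j : ℕ)
    (w : Equiv.Perm (Fin n)) (I J : Finset (Fin d)) (hIJ : Disjoint I J) :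
    eT q i j (sL t J * w) (fun k : Fin I.card => t (I.orderEmbOfFin rfl k)) =
    ∑ K ∈ I.powerset, q ^ K.card •
      (eW n i (sL t ((I \ K) ∪ J) * w) ⊗ₜ[ℂ] eW n j (sL t (K ∪ J) * w)) := by
  unfold eT
  set f : Fin I.card ↪ Fin d := (I.orderEmbOfFin rfl).toEmbedding with hf
  have hu : (Finset.univ : Finset (Fin I.card)).map f = I := by
    rw [hf]
    exact Finset.map_orderEmbOfFin_univ I rfl
  have ht' : IsOrthocell (fun k => t (f k)) := isOrthocell_comp ht f
  have hs : ∀ K, sL (fun k : Fin I.card => t (I.orderEmbOfFin rfl k)) K = sL t (K.map f) :=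
    fun K => sL_map ht f ht' K
  have hp : I.powerset = (Finset.univ : Finset (Finset (Fin I.card))).map
      (Finset.mapEmbedding f).toEmbedding := by
    ext K
    simp only [Finset.mem_powerset, Finset.mem_map, Finset.mem_univ, true_and]
    conv_lhs => rw [← hu]
    rw [Finset.subset_map_iff]
    simp [eq_comm]
  rw [hp, Finset.sum_map]
  refine Finset.sum_congr rfl fun K _ => ?_
  have hK : K.map f ⊆ I := by
    conv_rhs => rw [← hu]
    exact Finset.map_subset_map.2 (Finset.subset_univ _)
  have hc : Kᶜ.map f = I \ K.map f := by
    rw [Finset.compl_eq_univ_sdiff, Finset.map_sdiff, hu]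
  simp only [RelEmbedding.coe_toEmbedding, Finset.mapEmbedding_apply, Finset.card_map]
  rw [hs, hs, hc, sL_union ht (hIJ.mono_left Finset.sdiff_subset),
    sL_union ht (hIJ.mono_left hK), mul_assoc, mul_assoc]

theorem coeff_eq {d : ℕ} (q : ℂ) (x y : Fin d → ℂ) (I J K : Finset (Fin d))
    (hIJ : Disjoint I J) (hK : K ⊆ I) :
    q ^ (K ∪ J).card * (∏ k ∈ ((I \ K) ∪ J)ᶜ, x k) * (∏ k ∈ (K ∪ J)ᶜ, x k) *
      (∏ k ∈ (I \ K) ∪ J, y k) * (∏ k ∈ K ∪ J, y k) =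
    q ^ J.card * (∏ k ∈ (I ∪ J)ᶜ, x k) ^ 2 * (∏ k ∈ I, x k) * (∏ k ∈ I, y k) *
            (∏ k ∈ J, y k) ^ 2 * q ^ K.card := by
  have hKJ : Disjoint K J := hIJ.mono_left hK
  have hKJ' : Disjoint (I \ K) J := hIJ.mono_left Finset.sdiff_subset
  have hIJ' := Finset.disjoint_left.1 hIJ
  have e1 : ((I \ K) ∪ J)ᶜ = (I ∪ J)ᶜ ∪ K := by
    ext z
    have := @hK z
    have := @hIJ' z
    simp only [Finset.mem_compl, Finset.mem_union, Finset.mem_sdiff]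
    tauto
  have e2 : (K ∪ J)ᶜ = (I ∪ J)ᶜ ∪ (I \ K) := by
    ext z
    have := @hK z
    have := @hIJ' z
    simp only [Finset.mem_compl, Finset.mem_union, Finset.mem_sdiff]
    tauto
  have d1 : Disjoint (I ∪ J)ᶜ K := by
    rw [Finset.disjoint_left]
    intro z hz hzK
    simp [hK hzK] at hz
  have d2 : Disjoint (I ∪ J)ᶜ (I \ K) := by
    rw [Finset.disjoint_left]
    intro z hz hzK
    simp [(Finset.mem_sdiff.1 hzK).1] at hz
  rw [e1, e2, Finset.prod_union d1, Finset.prod_union d2, Finset.prod_union hKJ,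
    Finset.prod_union hKJ', Finset.card_union_of_disjoint hKJ, pow_add,
    ← Finset.prod_sdiff hK (f := x), ← Finset.prod_sdiff hK (f := y)]
  ring

theorem sum_reindex {d : ℕ} {V : Type*} [AddCommMonoid V]
    (F : Finset (Fin d) → Finset (Fin d) → V) :
    ∑ L, ∑ M, F L M =
      ∑ I : Finset (Fin d), ∑ J ∈ Iᶜ.powerset, ∑ K ∈ I.powerset, F ((I \ K) ∪ J) (K ∪ J) := by
  have h : ∀ I : Finset (Fin d), ∑ J ∈ Iᶜ.powerset, ∑ K ∈ I.powerset,
      F ((I \ K) ∪ J) (K ∪ J) =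
      ∑ p ∈ Iᶜ.powerset ×ˢ I.powerset, F ((I \ p.2) ∪ p.1) (p.2 ∪ p.1) := fun I =>
    (Finset.sum_product' _ _ (fun J K => F ((I \ K) ∪ J) (K ∪ J))).symm
  simp only [h]
  rw [← Finset.sum_product', Finset.sum_sigma']
  refine Finset.sum_nbij'
    (fun p => ⟨symmDiff p.1 p.2, (p.1 ∩ p.2, p.2 \ p.1)⟩)
    (fun s => ((s.1 \ s.2.2) ∪ s.2.1, s.2.2 ∪ s.2.1)) ?_ ?_ ?_ ?_ ?_
  · rintro ⟨L, M⟩ -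
    simp only [Finset.mem_sigma, Finset.mem_univ, true_and, Finset.mem_product,
      Finset.mem_powerset, Finset.subset_iff, Finset.mem_compl, Finset.mem_symmDiff,
      Finset.mem_inter, Finset.mem_sdiff]
    exact ⟨fun z => by tauto, fun z => by tauto⟩
  · intros
    simp
  · rintro ⟨L, M⟩ -
    refine Prod.ext ?_ ?_ <;> ext z <;>
      simp only [Finset.mem_union, Finset.mem_symmDiff,
        Finset.mem_inter, Finset.mem_sdiff] <;> tauto
  · rintro ⟨I, J, K⟩ hs
    simp only [Finset.mem_sigma, Finset.mem_univ, true_and, Finset.mem_product,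
      Finset.mem_powerset, Finset.subset_iff, Finset.mem_compl] at hs
    obtain ⟨h1, h2⟩ := hs
    have a1 : symmDiff ((I \ K) ∪ J) (K ∪ J) = I := by
      ext z
      have := @h1 z
      have := @h2 z
      simp only [Finset.mem_union, Finset.mem_symmDiff, Finset.mem_sdiff]
      tauto
    have a2 : ((I \ K) ∪ J) ∩ (K ∪ J) = J := by
      ext z
      simp only [Finset.mem_union, Finset.mem_inter, Finset.mem_sdiff]
      tauto
    have a3 : (K ∪ J) \ ((I \ K) ∪ J) = K := by
      ext z
      have := @h1 z
      have := @h2 z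
      simp only [Finset.mem_union, Finset.mem_sdiff]
      tauto
    simp only [a1, a2, a3]
  · rintro ⟨L, M⟩ -
    have b1 : (symmDiff L M \ (M \ L)) ∪ (L ∩ M) = L := by
      ext z
      simp only [Finset.mem_union, Finset.mem_symmDiff,
        Finset.mem_inter, Finset.mem_sdiff]
      tauto
    have b2 : (M \ L) ∪ (L ∩ M) = M := by
      ext z
      simp only [Finset.mem_union, Finset.mem_inter, Finset.mem_sdiff]
      tauto
    simp only [b1, b2]

/-- For a monogressive `ij`-effective orthocell datum
`C = (w; t_1, …, t_d)` and disjoint `I, J ⊆ {1, …, d}`, the datum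
`(s_J w; (t_k)_{k ∈ I})` is again monogressive and `ij`-effective; and for all scalars
`x_k, y_k` one has
`Σ_{L,M} q^{|M|} x_{L̄} x_{M̄} y_L y_M (e^i_{s_L w} ⊗ e^j_{s_M w})
  = Σ_{I ∩ J = ∅} q^{|J|} (x_{\overline{I∪J}})² x_I y_I (y_J)² e^{ij}_{(s_J w; (t_k)_{k∈I})}`. -/
theorem eT_change_of_variables {n d : ℕ} (i j : ℕ) (hi : 1 ≤ i) (hi' : i ≤ n - 1)
    (hj : 1 ≤ j) (hj' : j ≤ n - 1) (q : ℂ) (hq : q ≠ 0)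
    (w : Equiv.Perm (Fin n)) (t : Fin d → Fin n × Fin n)
    (ht : IsOrthocell t) (hmono : Monogressive w t)
    (heffi : Effective w t i) (heffj : Effective w t j) :
    (∀ I J : Finset (Fin d), Disjoint I J →
      IsOrthocell (fun k : Fin I.card => t (I.orderEmbOfFin rfl k)) ∧
      Monogressive (sL t J * w) (fun k : Fin I.card => t (I.orderEmbOfFin rfl k)) ∧
      Effective (sL t J * w) (fun k : Fin I.card => t (I.orderEmbOfFin rfl k)) i ∧
      Effective (sL t J * w) (fun k : Fin I.card => t (I.orderEmbOfFin rfl k)) j) ∧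
    ∀ x y : Fin d → ℂ,
      (∑ L : Finset (Fin d), ∑ M : Finset (Fin d),
        (q ^ M.card * (∏ k ∈ Lᶜ, x k) * (∏ k ∈ Mᶜ, x k) *
            (∏ k ∈ L, y k) * (∏ k ∈ M, y k)) •
          (eW n i (sL t L * w) ⊗ₜ[ℂ] eW n j (sL t M * w))) =
      ∑ I : Finset (Fin d), ∑ J ∈ Iᶜ.powerset,
        (q ^ J.card * (∏ k ∈ (I ∪ J)ᶜ, x k) ^ 2 * (∏ k ∈ I, x k) * (∏ k ∈ I, y k) *
            (∏ k ∈ J, y k) ^ 2) •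
          eT q i j (sL t J * w) (fun k : Fin I.card => t (I.orderEmbOfFin rfl k)) := by
  refine ⟨fun I J hIJ => ?_, fun x y => ?_⟩
  · have hJ : ∀ k, (I.orderEmbOfFin rfl).toEmbedding k ∉ J := fun k =>
      Finset.disjoint_left.1 hIJ (Finset.orderEmbOfFin_mem I rfl k)
    have ht' := isOrthocell_comp ht (I.orderEmbOfFin rfl).toEmbedding
    refine ⟨ht', ?_, effective_sub ht _ J hJ w i heffi, effective_sub ht _ J hJ w j heffj⟩
    intro K
    have hd : Disjoint (K.map (I.orderEmbOfFin rfl).toEmbedding) J := by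
      rw [Finset.disjoint_left]
      intro z hz
      obtain ⟨k, _, rfl⟩ := Finset.mem_map.1 hz
      exact hJ k
    have hs := sL_map ht (I.orderEmbOfFin rfl).toEmbedding ht' K
    have e : sL (fun k : Fin I.card => t (I.orderEmbOfFin rfl k)) K * (sL t J * w) =
        sL t (K.map (I.orderEmbOfFin rfl).toEmbedding ∪ J) * w := by
      rw [sL_union ht hd, mul_assoc, ← hs]
      rfl
    rw [e, hmono, hmono, Finset.card_union_of_disjoint hd, Finset.card_map]
    ring
  · rw [sum_reindex]
    refine Finset.sum_congr rfl fun I _ => Finset.sum_congr rfl fun J hJ => ?_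
    have hIJ : Disjoint I J := by
      rw [Finset.disjoint_right]
      intro z hz
      exact Finset.mem_compl.1 (Finset.mem_powerset.1 hJ hz)
    rw [eT_sub ht q i j w I J hIJ, Finset.smul_sum]
    refine Finset.sum_congr rfl fun K hK => ?_
    rw [smul_smul, coeff_eq q x y I J K hIJ (Finset.mem_powerset.1 hK)]

end QFlag
end
end
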